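/- arXiv:2507.11828 — 2 statements merged into one kernel-verified Lean document; each statement's English description precedes it below -/
import Mathlib

section
/- Let q be an odd prime and k ≥ 1 a natural number. Let S be a finite set of integers not containing a perfect q-th power. If S belongs to 𝒯_{k,q}, then |S| ≥ (q^{k+1} − 1)/(q − 1) = q^k + q^{k−1} + … + q + 1. -/
open Finset

/-- `S ∈ 𝒯_{k,q}`: there is a positive integer `Δ` such that for every natural number `N`
with `Ω(N) ≤ k` and `gcd(N, Δ) = 1`, some `s ∈ S` is a `q`-th power modulo `N`. -/
def MemT (q k : ℕ) (S : Set ℤ) : Prop :=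
  ∃ Δ : ℕ, 0 < Δ ∧ ∀ N : ℕ, 0 < N → N.primeFactorsList.length ≤ k → Nat.Coprime N Δ →
    ∃ s ∈ S, ∃ x : ℤ, (N : ℤ) ∣ x ^ q - s

/-- `s` is a perfect `q`-th power of an integer. -/
def IsPerfectPow (q : ℕ) (s : ℤ) : Prop := ∃ r : ℤ, r ^ q = s

/-- The finite set of primes dividing `∏_{s ∈ S} rad_q(|s|)`, i.e. the primes `p` such that
`q ∤ v_p(|s|)` for some `s ∈ S`. -/
def qPrimes (q : ℕ) (S : Finset ℤ) : Finset ℕ :=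
  S.sup fun s => s.natAbs.primeFactors.filter fun p => ¬ q ∣ s.natAbs.factorization p

/-- The vector `(v_{p_1}(|u|) mod q, …, v_{p_n}(|u|) mod q)` where `p_1 < … < p_n`
is the increasing enumeration of the finite set of primes `P`. -/
def vecOf (q : ℕ) (P : Finset ℕ) (u : ℤ) : Fin P.card → ZMod q :=
  fun i => ((u.natAbs.factorization (P.orderIsoOfFin rfl i).1 : ℕ) : ZMod q)

/-- The projective point `⟨v⟩` of `PG(F_q^n)` spanned by a vector `v`. -/
def projPoint {q n : ℕ} (v : Fin n → ZMod q) : Submodule (ZMod q) (Fin n → ZMod q) :=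
  Submodule.span (ZMod q) {v}

/-- The set of projective points associated with `S` in `PG(F_q^n)`,
`n` being the number of distinct primes dividing `∏_{s ∈ S} rad_q(|s|)`. -/
def assocPoints (q : ℕ) (S : Finset ℤ) :
    Set (Submodule (ZMod q) (Fin (qPrimes q S).card → ZMod q)) :=
  {P | ∃ s ∈ S, P = projPoint (vecOf q (qPrimes q S) s)}

/-- `B` is a `k`-blocking set of `PG(F_q^n)`: every subspace of codimension `k`
contains a nonzero vector spanning a point of `B`. -/
def IsBlockingSet (q n k : ℕ) (B : Set (Submodule (ZMod q) (Fin n → ZMod q))) : Prop :=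
  ∀ W : Submodule (ZMod q) (Fin n → ZMod q), Module.finrank (ZMod q) W = n - k →
    ∃ v ∈ W, v ≠ 0 ∧ projPoint v ∈ B

/-- `B` is (the point set of) a `k`-space of `PG(F_q^n)`. -/
def IsKSpace (q n k : ℕ) (B : Set (Submodule (ZMod q) (Fin n → ZMod q))) : Prop :=
  ∃ W : Submodule (ZMod q) (Fin n → ZMod q), Module.finrank (ZMod q) W = k + 1 ∧
    B = {P | ∃ v ∈ W, v ≠ 0 ∧ P = projPoint v}

/-- `S` and `T` are geometrically `q`-equivalent: some element of `PGL(n, q)` maps the point set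
associated with `S` onto the point set associated with `T`, where the points are computed with
respect to all the primes dividing `(∏_{s ∈ S} rad_q(|s|)) ⬝ (∏_{t ∈ T} rad_q(|t|))`. -/
def GeomEquiv (q : ℕ) (S T : Finset ℤ) : Prop :=
  ∃ Ψ : (Fin (qPrimes q (S ∪ T)).card → ZMod q) ≃ₗ[ZMod q]
        (Fin (qPrimes q (S ∪ T)).card → ZMod q),
    (Submodule.map Ψ.toLinearMap) ''
        {P | ∃ s ∈ S, P = projPoint (vecOf q (qPrimes q (S ∪ T)) s)} =
      {P | ∃ t ∈ T, P = projPoint (vecOf q (qPrimes q (S ∪ T)) t)}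

/-- The set of squares of `F_qˣ` together with `0`. -/
def Q0 (q : ℕ) : Set (ZMod q) := {x | (∃ a : ZMod q, a ≠ 0 ∧ a ^ 2 = x) ∨ x = 0}

section PartA
open NumberField Filter Topology

/-- weight -/
noncomputable def zw (s : ℝ) (n : ℕ) : ENNReal := if n = 0 then 0 else ENNReal.ofReal ((n:ℝ)^(-s))

lemma zw_mul (s : ℝ) (m n : ℕ) : zw s (m*n) = zw s m * zw s n := by
  unfold zw
  by_cases hm : m = 0
  · simp [hm]
  by_cases hn : n = 0
  · simp [hn]
  simp only [mul_eq_zero, hm, hn, or_self, if_false]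
  rw [← ENNReal.ofReal_mul (by positivity), ← Real.mul_rpow (by positivity) (by positivity)]
  push_cast; rfl

lemma zw_le_half (s : ℝ) (hs : 1 < s) (n : ℕ) (hn : 2 ≤ n) : zw s n ≤ 2⁻¹ := by
  unfold zw
  rw [if_neg (by omega)]
  rw [show (2⁻¹ : ENNReal) = ENNReal.ofReal (2⁻¹) by
    rw [ENNReal.ofReal_inv_of_pos (by norm_num)]; simp]
  apply ENNReal.ofReal_le_ofReal
  have h2 : (2:ℝ) ≤ n := by exact_mod_cast hn
  calc (n:ℝ)^(-s) ≤ (n:ℝ)^(-1:ℝ) := Real.rpow_le_rpow_of_exponent_le (by linarith) (by linarith)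
    _ = (n:ℝ)⁻¹ := Real.rpow_neg_one _
    _ ≤ 2⁻¹ := by gcongr

noncomputable def zz (K : Type*) [Field K] [NumberField K] (A : Set (Ideal (𝓞 K))) (s : ℝ) : ENNReal :=
  ∑' I : A, zw s (Ideal.absNorm I.1)

lemma zz_univ (K : Type*) [Field K] [NumberField K] (s : ℝ) (h : dedekindZeta K s ≠ 0) :
    zz K Set.univ s = ENNReal.ofReal (dedekindZeta K s).re := by
  have hsum : Summable (LSeries.term (fun n ↦ (Nat.card {I : Ideal (𝓞 K) // Ideal.absNorm I = n} : ℂ)) s) := by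
    by_contra hc
    exact h (tsum_eq_zero_of_not_summable hc)
  have hterm : ∀ n, LSeries.term (fun n ↦ (Nat.card {I : Ideal (𝓞 K) // Ideal.absNorm I = n} : ℂ)) s n
     = ((if n = 0 then 0 else (Nat.card {I : Ideal (𝓞 K) // Ideal.absNorm I = n} : ℝ) * (n:ℝ)^(-s) : ℝ) : ℂ) := by
    intro n
    rw [LSeries.term_def]
    split_ifs with h0
    · simp
    · rw [div_eq_mul_inv, ← Complex.cpow_neg]
      push_cast
      rw [Complex.ofReal_cpow (by positivity)]
      simp
  have h1 : dedekindZeta K s = ((∑' n : ℕ, (if n = 0 then 0 else (Nat.card {I : Ideal (𝓞 K) // Ideal.absNorm I = n} : ℝ) * (n:ℝ)^(-s) : ℝ) : ℝ) : ℂ) := by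
    rw [Complex.ofReal_tsum]
    exact tsum_congr hterm
  rw [h1, Complex.ofReal_re]
  have hsum' : Summable (fun n : ℕ => (if n = 0 then 0 else (Nat.card {I : Ideal (𝓞 K) // Ideal.absNorm I = n} : ℝ) * (n:ℝ)^(-s) : ℝ)) := by
    rw [← Complex.summable_ofReal]
    exact hsum.congr hterm
  rw [ENNReal.ofReal_tsum_of_nonneg _ hsum']
  · unfold zz
    rw [tsum_univ (fun I : Ideal (𝓞 K) => zw s (Ideal.absNorm I))]
    rw [← (Equiv.sigmaFiberEquiv (fun I : Ideal (𝓞 K) => Ideal.absNorm I)).tsum_eq]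
    rw [ENNReal.tsum_sigma']
    refine tsum_congr fun n => ?_
    have : ∀ b : {I : Ideal (𝓞 K) // Ideal.absNorm I = n}, zw s (Ideal.absNorm ((Equiv.sigmaFiberEquiv (fun I : Ideal (𝓞 K) => Ideal.absNorm I)) ⟨n, b⟩)) = zw s n := by
      rintro ⟨b, hb⟩
      simp [Equiv.sigmaFiberEquiv, hb]
    rw [tsum_congr this]
    unfold zw
    split_ifs with h0
    · simp
    · have : Finite {I : Ideal (𝓞 K) // Ideal.absNorm I = n} := Ideal.finite_setOfPred_absNorm_eq n
      have := Fintype.ofFinite {I : Ideal (𝓞 K) // Ideal.absNorm I = n}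
      rw [tsum_fintype, Finset.sum_const, Nat.card_eq_fintype_card, nsmul_eq_mul,
        ENNReal.ofReal_mul (by positivity)]
      simp
  · intro n
    split_ifs <;> positivity

lemma zz_tendsto (K : Type*) [Field K] [NumberField K] :
    Tendsto (fun s : ℝ => ENNReal.ofReal (s-1) * zz K Set.univ s) (𝓝[>] 1)
      (𝓝 (ENNReal.ofReal (dedekindZeta_residue K))) := by
  have h := tendsto_sub_one_mul_dedekindZeta_nhdsGT K
  have hne : ∀ᶠ s : ℝ in 𝓝[>] 1, ((s:ℂ) - 1) * dedekindZeta K s ≠ 0 :=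
    h.eventually_ne (by exact_mod_cast dedekindZeta_residue_ne_zero K)
  have h2 := ENNReal.tendsto_ofReal ((Complex.continuous_re.tendsto _).comp h)
  rw [Complex.ofReal_re] at h2
  refine h2.congr' ?_
  filter_upwards [hne, self_mem_nhdsWithin] with s hs hs1
  have hs1 : 1 < s := hs1
  rw [zz_univ K s (right_ne_zero_of_mul hs), ← ENNReal.ofReal_mul (by linarith)]
  congr 1
  simp

lemma zz_fin (K : Type*) [Field K] [NumberField K] : ∀ᶠ s : ℝ in 𝓝[>] 1, zz K Set.univ s ≠ ⊤ := by
  have h := tendsto_sub_one_mul_dedekindZeta_nhdsGT K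
  have hne : ∀ᶠ s : ℝ in 𝓝[>] 1, ((s:ℂ) - 1) * dedekindZeta K s ≠ 0 :=
    h.eventually_ne (by exact_mod_cast dedekindZeta_residue_ne_zero K)
  filter_upwards [hne] with s hs
  rw [zz_univ K s (right_ne_zero_of_mul hs)]
  simp

lemma zz_mono {K : Type*} [Field K] [NumberField K] {A B : Set (Ideal (𝓞 K))} (h : A ⊆ B) (s : ℝ) :
    zz K A s ≤ zz K B s := ENNReal.tsum_mono_subtype (fun I : Ideal (𝓞 K) => zw s (Ideal.absNorm I)) h

def goodI (K : Type*) [Field K] [NumberField K] (F : Finset (Ideal (𝓞 K))) : Set (Ideal (𝓞 K)) :=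
  {I | I ≠ ⊥ ∧ ∀ Q ∈ F, ¬ Q ∣ I}

lemma zz_bad {K : Type*} [Field K] [NumberField K] (s : ℝ) (hs : 1 < s) (hfin : zz K Set.univ s ≠ ⊤)
    (F : Finset (Ideal (𝓞 K))) (hF : ∀ Q ∈ F, Q.IsPrime ∧ Q ≠ ⊥) :
    zz K Set.univ s ≤ 2 ^ F.card * zz K (goodI K F) s := by
  classical
  induction F using Finset.induction_on with
  | empty =>
    simp only [Finset.card_empty, pow_zero, one_mul]
    have : zz K Set.univ s ≤ zz K {⊥} s + zz K (goodI K ∅) s := by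
      have h1 : (Set.univ : Set (Ideal (𝓞 K))) = {⊥} ∪ goodI K ∅ := by
        ext I; simp [goodI, em]
      rw [h1]
      exact ENNReal.tsum_union_le (fun I : Ideal (𝓞 K) => zw s (Ideal.absNorm I)) _ _
    have h0 : zz K {⊥} s = 0 := by
      simp [zz, zw]
    rwa [h0, zero_add] at this
  | insert Q F hQ ih =>
    have ih := ih (fun P hP => hF P (Finset.mem_insert_of_mem hP))
    obtain ⟨hQp, hQb⟩ := hF Q (Finset.mem_insert_self _ _)
    rw [Finset.card_insert_of_notMem hQ, pow_succ, mul_assoc]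
    refine ih.trans ?_
    gcongr
    have hsub : goodI K F ⊆ goodI K (insert Q F) ∪ (fun J => Q * J) '' goodI K F := by
      intro I hI
      by_cases h : Q ∣ I
      · right
        obtain ⟨J, rfl⟩ := h
        refine ⟨J, ⟨?_, ?_⟩, rfl⟩
        · rintro rfl; exact hI.1 (by simp)
        · intro P hP hd
          exact hI.2 P hP (hd.mul_left Q)
      · left
        refine ⟨hI.1, ?_⟩
        intro P hP
        rcases Finset.mem_insert.1 hP with rfl | hP
        · exact h
        · exact hI.2 P hP
    have h1 : zz K (goodI K F) s ≤ zz K (goodI K (insert Q F)) s + zz K ((fun J => Q * J) '' goodI K F) s :=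
      (zz_mono hsub s).trans (ENNReal.tsum_union_le (fun I : Ideal (𝓞 K) => zw s (Ideal.absNorm I)) _ _)
    have h2 : zz K ((fun J => Q * J) '' goodI K F) s ≤ 2⁻¹ * zz K (goodI K F) s := by
      unfold zz
      rw [tsum_image (g := fun J => Q * J) (fun I : Ideal (𝓞 K) => zw s (Ideal.absNorm I))]
      · rw [← ENNReal.tsum_mul_left]
        refine ENNReal.tsum_le_tsum fun I => ?_
        rw [map_mul, zw_mul]
        gcongr
        apply zw_le_half s hs
        have h0 : Ideal.absNorm Q ≠ 0 := by rwa [Ne, Ideal.absNorm_eq_zero_iff]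
        have h1 : Ideal.absNorm Q ≠ 1 := by
          rw [Ne, Ideal.absNorm_eq_one_iff]; exact hQp.ne_top
        omega
      · intro a ha b hb hab
        exact mul_left_cancel₀ hQb hab
    have hf : zz K (goodI K F) s ≠ ⊤ := ne_top_of_le_ne_top hfin (zz_mono (Set.subset_univ _) s)
    set X := zz K (goodI K F) s
    set Y := zz K (goodI K (insert Q F)) s
    have h3 : X ≤ Y + 2⁻¹ * X := h1.trans (by gcongr)
    have h4 : X = 2⁻¹ * X + 2⁻¹ * X := by
      rw [← add_mul, ENNReal.inv_two_add_inv_two, one_mul]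
    have h5 : 2⁻¹ * X ≤ Y := by
      have hf2 : 2⁻¹ * X ≠ ⊤ := ENNReal.mul_ne_top (by simp) hf
      rw [← ENNReal.add_le_add_iff_right hf2]
      rwa [← h4]
    calc X = 2 * (2⁻¹ * X) := by
          rw [← mul_assoc, ENNReal.mul_inv_cancel (by simp) (by simp), one_mul]
      _ ≤ 2 * Y := by gcongr

structure SplitData (K L : Type*) [Field K] [NumberField K] [Field L] [NumberField L]
    (F : Finset (Ideal (𝓞 K))) (c d : Ideal (𝓞 K) → Ideal (𝓞 L)) (u : Ideal (𝓞 L) → Ideal (𝓞 K)) (P : Ideal (𝓞 K)) : Prop where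
  cprime : Prime (c P)
  dprime : Prime (d P)
  uc : u (c P) = P
  ud : u (d P) = P
  ne : d P ≠ c P
  nc : Ideal.absNorm (c P) = Ideal.absNorm P
  nd : Ideal.absNorm (d P) = Ideal.absNorm P

open UniqueFactorizationMonoid in
lemma zz_sq {K L : Type*} [Field K] [NumberField K] [Field L] [NumberField L]
    (F : Finset (Ideal (𝓞 K))) (c d : Ideal (𝓞 K) → Ideal (𝓞 L)) (u : Ideal (𝓞 L) → Ideal (𝓞 K))
    (h : ∀ P : Ideal (𝓞 K), P.IsPrime → P ≠ ⊥ → P ∉ F → SplitData K L F c d u P) (s : ℝ) :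
    zz K (goodI K F) s * zz K (goodI K F) s ≤ zz L Set.univ s := by
  classical
  have hgood : ∀ a ∈ goodI K F, ∀ P ∈ normalizedFactors a, SplitData K L F c d u P := by
    intro a ha P hP
    have hp := prime_of_normalized_factor P hP
    refine h P (Ideal.isPrime_of_prime hp) hp.ne_zero ?_
    intro hF
    exact ha.2 P hF (dvd_of_mem_normalizedFactors hP)
  let Φ : (goodI K F) × (goodI K F) → Ideal (𝓞 L) := fun x =>
    ((normalizedFactors x.1.1).map c).prod * ((normalizedFactors x.2.1).map d).prod
  have hprod : ∀ a ∈ goodI K F, (normalizedFactors a).prod = a := fun a ha =>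
    Ideal.prod_normalizedFactors_eq_self ha.1
  have hnf : ∀ x, normalizedFactors (Φ x) = (normalizedFactors x.1.1).map c + (normalizedFactors x.2.1).map d := by
    intro x
    simp only [Φ]
    rw [← Multiset.prod_add]
    apply normalizedFactors_prod_of_prime
    intro p hp
    rcases Multiset.mem_add.1 hp with hp | hp
    · obtain ⟨P, hP, rfl⟩ := Multiset.mem_map.1 hp
      exact (hgood _ x.1.2 P hP).cprime
    · obtain ⟨P, hP, rfl⟩ := Multiset.mem_map.1 hp
      exact (hgood _ x.2.2 P hP).dprime
  have hfil : ∀ x, (normalizedFactors (Φ x)).filter (fun X => X = c (u X)) = (normalizedFactors x.1.1).map c := by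
    intro x
    rw [hnf, Multiset.filter_add]
    have h1 : ((normalizedFactors x.1.1).map c).filter (fun X => X = c (u X)) = (normalizedFactors x.1.1).map c := by
      rw [Multiset.filter_eq_self]
      intro X hX
      obtain ⟨P, hP, rfl⟩ := Multiset.mem_map.1 hX
      rw [(hgood _ x.1.2 P hP).uc]
    have h2 : ((normalizedFactors x.2.1).map d).filter (fun X => X = c (u X)) = 0 := by
      rw [Multiset.filter_eq_nil]
      intro X hX
      obtain ⟨P, hP, rfl⟩ := Multiset.mem_map.1 hX
      rw [(hgood _ x.2.2 P hP).ud]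
      exact (hgood _ x.2.2 P hP).ne
    rw [h1, h2, add_zero]
  have hc : ∀ a ∈ goodI K F, ((normalizedFactors a).map c).map u = normalizedFactors a := by
    intro a ha
    rw [Multiset.map_map]
    conv_rhs => rw [← Multiset.map_id (normalizedFactors a)]
    exact Multiset.map_congr rfl (fun P hP => (hgood a ha P hP).uc)
  have hd : ∀ a ∈ goodI K F, ((normalizedFactors a).map d).map u = normalizedFactors a := by
    intro a ha
    rw [Multiset.map_map]
    conv_rhs => rw [← Multiset.map_id (normalizedFactors a)]
    exact Multiset.map_congr rfl (fun P hP => (hgood a ha P hP).ud)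
  have hinj : Function.Injective Φ := by
    intro x y hxy
    have h1 : (normalizedFactors x.1.1).map c = (normalizedFactors y.1.1).map c := by
      rw [← hfil, ← hfil, hxy]
    have h2 : (normalizedFactors x.2.1).map d = (normalizedFactors y.2.1).map d := by
      have := hnf x
      rw [hxy, hnf y, h1] at this
      exact (add_left_cancel this).symm
    have h3 : x.1.1 = y.1.1 := by
      rw [← hprod _ x.1.2, ← hprod _ y.1.2, ← hc _ x.1.2, ← hc _ y.1.2, h1]
    have h4 : x.2.1 = y.2.1 := by
      rw [← hprod _ x.2.2, ← hprod _ y.2.2, ← hd _ x.2.2, ← hd _ y.2.2, h2]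
    exact Prod.ext (Subtype.ext h3) (Subtype.ext h4)
  have hnorm : ∀ x, Ideal.absNorm (Φ x) = Ideal.absNorm x.1.1 * Ideal.absNorm x.2.1 := by
    intro x
    simp only [Φ]
    rw [map_mul, map_multiset_prod, map_multiset_prod, Multiset.map_map, Multiset.map_map]
    conv_rhs => rw [← hprod _ x.1.2, ← hprod _ x.2.2]
    rw [map_multiset_prod, map_multiset_prod]
    congr 2
    · exact Multiset.map_congr rfl (fun P hP => (hgood _ x.1.2 P hP).nc)
    · exact Multiset.map_congr rfl (fun P hP => (hgood _ x.2.2 P hP).nd)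
  calc zz K (goodI K F) s * zz K (goodI K F) s
      = ∑' x : (goodI K F) × (goodI K F), zw s (Ideal.absNorm x.1.1) * zw s (Ideal.absNorm x.2.1) := by
        rw [ENNReal.tsum_prod' (f := fun x : (goodI K F) × (goodI K F) => zw s (Ideal.absNorm x.1.1) * zw s (Ideal.absNorm x.2.1))]
        simp only [ENNReal.tsum_mul_left, ENNReal.tsum_mul_right]
        rfl
    _ = ∑' x : (goodI K F) × (goodI K F), zw s (Ideal.absNorm (Φ x)) := by
        refine tsum_congr fun x => ?_
        rw [hnorm, zw_mul]
    _ ≤ ∑' I : Ideal (𝓞 L), zw s (Ideal.absNorm I) :=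
        ENNReal.tsum_comp_le_tsum_of_injective hinj (fun I : Ideal (𝓞 L) => zw s (Ideal.absNorm I))
    _ = zz L Set.univ s := (tsum_univ (fun I : Ideal (𝓞 L) => zw s (Ideal.absNorm I))).symm

theorem zeta_contra {K L : Type*} [Field K] [NumberField K] [Field L] [NumberField L]
    (F : Finset (Ideal (𝓞 K))) (hF : ∀ Q ∈ F, Q.IsPrime ∧ Q ≠ ⊥)
    (c d : Ideal (𝓞 K) → Ideal (𝓞 L)) (u : Ideal (𝓞 L) → Ideal (𝓞 K))
    (h : ∀ P : Ideal (𝓞 K), P.IsPrime → P ≠ ⊥ → P ∉ F → SplitData K L F c d u P) : False := by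
  have hK := zz_tendsto K
  have hL := zz_tendsto L
  have hs : Tendsto (fun s : ℝ => ENNReal.ofReal (s-1)) (𝓝[>] 1) (𝓝 0) := by
    have : Tendsto (fun s : ℝ => s-1) (𝓝[>] 1) (𝓝 0) := by
      have : Tendsto (fun s : ℝ => s-1) (𝓝 1) (𝓝 (1-1)) := (continuous_id.sub continuous_const).tendsto 1
      rw [sub_self] at this
      exact this.mono_left nhdsWithin_le_nhds
    simpa using ENNReal.tendsto_ofReal this
  have hR := ENNReal.Tendsto.mul hs (Or.inr ENNReal.ofReal_ne_top) hL (Or.inr (by simp))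
  have hR2 := ENNReal.Tendsto.const_mul (a := (2^F.card * 2^F.card : ENNReal)) hR (Or.inr (by finiteness))
  have hKK := ENNReal.Tendsto.mul hK (Or.inr ENNReal.ofReal_ne_top) hK (Or.inr ENNReal.ofReal_ne_top)
  rw [zero_mul, mul_zero] at hR2
  have hle := le_of_tendsto_of_tendsto hKK hR2 (by
    filter_upwards [zz_fin K, self_mem_nhdsWithin] with s hf hs1
    have h1 := zz_bad s hs1 hf F hF
    have h2 := zz_sq F c d u h s
    calc _ ≤ ENNReal.ofReal (s-1) * (2 ^ F.card * zz K (goodI K F) s) * (ENNReal.ofReal (s-1) * (2 ^ F.card * zz K (goodI K F) s)) := by gcongr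
      _ = (2^F.card * 2^F.card : ENNReal) * (ENNReal.ofReal (s-1) * (ENNReal.ofReal (s-1) * (zz K (goodI K F) s * zz K (goodI K F) s))) := by ring
      _ ≤ _ := by gcongr)
  have hpos := dedekindZeta_residue_pos K
  simp at hle
  linarith

end PartA

section PartB
open NumberField Filter Topology
open scoped Pointwise

theorem galois_contra {K L : Type*} [Field K] [NumberField K] [Field L] [NumberField L] [Algebra K L]
    [IsGalois K L] (g : Gal(L/K)) (hg : g ≠ 1) (B : ℕ) (hB : B ≠ 0)
    (h : ∀ P' : Ideal (𝓞 L), P'.IsPrime → P' ≠ ⊥ → (B : 𝓞 L) ∉ P' → ∀ σ : Gal(L/K), σ • P' = P' → σ = 1) :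
    False := by
  classical
  have hex : ∀ P : Ideal (𝓞 K), P.IsPrime → ∃ P' : Ideal (𝓞 L), P'.IsPrime ∧ P'.LiesOver P := by
    intro P hP
    obtain ⟨Q⟩ := (inferInstance : Nonempty (Ideal.primesOver P (𝓞 L)))
    exact ⟨Q.1, Q.2.1, Q.2.2⟩
  let c : Ideal (𝓞 K) → Ideal (𝓞 L) := fun P => if hP : P.IsPrime then (hex P hP).choose else ⊥
  let F : Finset (Ideal (𝓞 K)) := (UniqueFactorizationMonoid.normalizedFactors (Ideal.span {(B : 𝓞 K)})).toFinset
  have hB0 : Ideal.span {(B : 𝓞 K)} ≠ ⊥ := by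
    rw [Ne, Ideal.span_singleton_eq_bot]; exact_mod_cast hB
  refine zeta_contra F ?_ c (fun P => g • c P) (fun P' => P'.under (𝓞 K)) ?_
  · intro Q hQ
    have := UniqueFactorizationMonoid.prime_of_normalized_factor Q (Multiset.mem_toFinset.1 hQ)
    exact ⟨Ideal.isPrime_of_prime this, this.ne_zero⟩
  · intro P hP hPb hPF
    have hcP : c P = (hex P hP).choose := by simp only [c]; rw [dif_pos hP]
    have h1 : (c P).IsPrime := by rw [hcP]; exact (hex P hP).choose_spec.1
    have h2 : (c P).LiesOver P := by rw [hcP]; exact (hex P hP).choose_spec.2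
    have hcb : c P ≠ ⊥ := Ideal.ne_bot_of_liesOver_of_ne_bot hPb (c P)
    have hBP : (B : 𝓞 L) ∉ c P := by
      intro hm
      apply hPF
      rw [Multiset.mem_toFinset]
      have hPp : Prime P := Ideal.prime_of_isPrime hPb hP
      rw [Ideal.mem_normalizedFactors_iff hB0]
      refine ⟨hP, ?_⟩
      rw [Ideal.span_singleton_le_iff_mem, h2.over, Ideal.mem_comap]
      simpa using hm
    have hst := h (c P) h1 hcb hBP
    have hstab : Nat.card (MulAction.stabilizer Gal(L/K) (c P)) = 1 := by
      rw [Subgroup.card_eq_one, Subgroup.eq_bot_iff_forall]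
      intro σ hσ
      exact hst σ hσ
    have hperf : PerfectField P.ResidueField := by
      have := P.finiteQuotientOfFreeOfNeBot hPb
      have : P.IsMaximal := hP.isMaximal hPb
      have : Finite P.ResidueField := Finite.of_surjective _ P.bijective_algebraMap_quotient_residueField.2
      infer_instance
    have hPmax : P.IsMaximal := hP.isMaximal hPb
    have hcmax : (c P).IsMaximal := h1.isMaximal hcb
    have hid : (c P).inertiaDeg (𝓞 K) = 1 := by
      have := Ideal.card_stabilizer_eq_card_inertia_mul_finrank (G := Gal(L/K)) P (c P)
      rw [hstab] at this
      exact Nat.eq_one_of_mul_eq_one_left this.symm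
    have hnorm : ∀ Q : Ideal (𝓞 L), Q.IsMaximal → Q.LiesOver P → Q.inertiaDeg (𝓞 K) = 1 → Ideal.absNorm Q = Ideal.absNorm P := by
      intro Q _ _ hQ
      rw [Ideal.absNorm_eq_pow_inertiaDeg'_of_liesOver Q P hP hPb, Ideal.inertiaDeg'_eq_inertiaDeg, hQ, pow_one]
    have hdprime : (g • c P).IsPrime := inferInstance
    have hdover : (g • c P).LiesOver P := inferInstance
    have hdb : g • c P ≠ ⊥ := Ideal.ne_bot_of_liesOver_of_ne_bot hPb (g • c P)
    refine ⟨Ideal.prime_of_isPrime hcb h1, Ideal.prime_of_isPrime hdb hdprime, ?_, ?_, ?_, ?_, ?_⟩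
    · exact h2.over.symm
    · exact hdover.over.symm
    · intro he
      exact hg (hst g he)
    · exact hnorm _ hcmax h2 hid
    · refine hnorm _ (hdprime.isMaximal hdb) hdover ?_
      rw [Ideal.inertiaDeg_smul, hid]

theorem kummer_prime {L : Type*} [Field L] [NumberField L] (q : ℕ) (hq : q.Prime)
    (g : Gal(L/ℚ)) (hgq : g ^ q = 1) (ζ : L) (hζ : IsPrimitiveRoot ζ q) (hgζ : g ζ = ζ)
    [IsGalois ℚ L] (S : Finset ℤ) (h0 : ∀ s ∈ S, s ≠ 0) (b : ℤ → L) (hb : ∀ s ∈ S, b s ^ q = s)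
    (Δ : ℕ) (hΔ : Δ ≠ 0) :
    ∃ p : ℕ, p.Prime ∧ ¬ p ∣ Δ ∧ ∀ s ∈ S, (∃ x : ℤ, (p:ℤ) ∣ x ^ q - s) → g (b s) = b s := by
  by_cases hg1 : g = 1
  · obtain ⟨p, hp1, hp2⟩ := Nat.exists_infinite_primes (Δ + 1)
    refine ⟨p, hp2, fun hd => ?_, fun s _ _ => by simp [hg1]⟩
    have := Nat.le_of_dvd (by omega) hd
    omega
  by_contra hcon
  push Not at hcon
  let H := Subgroup.zpowers g
  let E := IntermediateField.fixedField H
  have hfact := Fact.mk hq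
  have hord : orderOf g = q := orderOf_eq_prime hgq hg1
  have hcard : Nat.card H = q := by rw [Nat.card_zpowers, hord]
  have hfix : E.fixingSubgroup = H := IntermediateField.fixingSubgroup_fixedField H
  -- restriction of scalars
  have hmem : ∀ σ : Gal(L/E), σ.restrictScalars ℚ ∈ H := by
    intro σ
    rw [← hfix, IntermediateField.mem_fixingSubgroup_iff]
    intro x hx
    exact σ.commutes ⟨x, hx⟩
  have hζE : ζ ∈ E := by
    rw [IntermediateField.mem_fixedField_iff]
    intro f hf
    obtain ⟨n, rfl⟩ := Subgroup.mem_zpowers_iff.1 hf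
    have : g ∈ MulAction.stabilizer Gal(L/ℚ) ζ := hgζ
    exact (MulAction.stabilizer Gal(L/ℚ) ζ).zpow_mem this n
  have hkey : ∀ σ : Gal(L/E), σ ≠ 1 → ∀ y : L, σ y = y → g y = y := by
    intro σ hσ y hy
    have h1 : (⟨σ.restrictScalars ℚ, hmem σ⟩ : H) ≠ 1 := by
      intro h
      apply hσ
      have h2 : σ.restrictScalars ℚ = 1 := congrArg Subtype.val h
      ext z
      exact DFunLike.congr_fun h2 z
    have h2 := mem_zpowers_of_prime_card hcard h1 (g' := ⟨g, Subgroup.mem_zpowers g⟩)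
    obtain ⟨n, hn⟩ := Subgroup.mem_zpowers_iff.1 h2
    have h3 : (σ.restrictScalars ℚ : Gal(L/ℚ)) ^ n = g := by
      have := congrArg Subtype.val hn
      simpa using this
    rw [← h3]
    have : (σ.restrictScalars ℚ : Gal(L/ℚ)) ∈ MulAction.stabilizer Gal(L/ℚ) y := hy
    exact (MulAction.stabilizer Gal(L/ℚ) y).zpow_mem this n
  have hgE : g ∈ E.fixingSubgroup := by rw [hfix]; exact Subgroup.mem_zpowers g
  let g' : Gal(L/E) := IntermediateField.fixingSubgroupEquiv E ⟨g, hgE⟩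
  have hg' : g' ≠ 1 := by
    intro h
    have := (IntermediateField.fixingSubgroupEquiv E).map_eq_one_iff.1 h
    exact hg1 (congrArg Subtype.val this)
  -- integral elements
  let ζ' : 𝓞 L := ⟨ζ, hζ.isIntegral hq.pos⟩
  have hζ' : IsPrimitiveRoot ζ' q := by
    refine IsPrimitiveRoot.of_map_of_injective (f := algebraMap (𝓞 L) L) ?_ RingOfIntegers.coe_injective
    exact hζ
  have hfixroot : ∀ (σ : Gal(L/E)) (η : 𝓞 L), η ^ q = 1 → σ • η = η := by
    intro σ η hη
    obtain ⟨i, -, rfl⟩ := hζ'.eq_pow_of_pow_eq_one hη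
    rw [smul_pow']
    congr 1
    apply RingOfIntegers.ext
    exact σ.commutes ⟨ζ, hζE⟩
  let B : ℕ := q * Δ * ∏ s ∈ S, s.natAbs
  have hB : B ≠ 0 := by
    refine mul_ne_zero (mul_ne_zero hq.ne_zero hΔ) ?_
    rw [Finset.prod_ne_zero_iff]
    intro s hs
    simpa using h0 s hs
  refine galois_contra g' hg' B hB ?_
  intro P hP hPb hBP σ hσ
  by_contra hσ1
  have hmemσ : ∀ x ∈ P, σ • x ∈ P := by
    intro x hx
    rw [← hσ]; exact Ideal.smul_mem_pointwise_smul σ x P hx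
  -- prime below
  obtain ⟨p, hp, hpP⟩ : ∃ p : ℕ, p.Prime ∧ (p : 𝓞 L) ∈ P := by
    have hN : Ideal.absNorm P ≠ 0 := by rwa [Ne, Ideal.absNorm_eq_zero_iff]
    have hmem : (Ideal.absNorm P : 𝓞 L) ∈ P := Ideal.absNorm_mem P
    rw [← Nat.prod_primeFactorsList hN] at hmem
    rw [Nat.cast_list_prod, ← Multiset.prod_coe, hP.multiset_prod_mem_iff_exists_mem] at hmem
    obtain ⟨y, hy, hyP⟩ := hmem
    obtain ⟨p, hp, rfl⟩ := List.mem_map.1 (Multiset.mem_coe.1 hy)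
    exact ⟨p, Nat.prime_of_mem_primeFactorsList hp, hyP⟩
  have hdvdB : ∀ n : ℕ, n ∣ B → (n : 𝓞 L) ∉ P := by
    rintro n ⟨m, hm⟩ hn
    apply hBP
    rw [hm]; push_cast
    exact P.mul_mem_right _ hn
  have hpΔ : ¬ p ∣ Δ := by
    intro hd
    exact hdvdB p (hd.trans ⟨q * ∏ s ∈ S, s.natAbs, by simp only [B]; ring⟩) hpP
  obtain ⟨s, hs, ⟨x, hx⟩, hgs⟩ := hcon p hp hpΔ
  have hbInt : IsIntegral ℤ (b s) := by
    apply IsIntegral.of_pow hq.pos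
    rw [hb s hs]
    exact isIntegral_algebraMap (R := ℤ) (A := L) (x := s)
  let β : 𝓞 L := ⟨b s, hbInt⟩
  have hβ : β ^ q = (s : 𝓞 L) := by
    apply RingOfIntegers.coe_injective
    rw [map_pow, map_intCast]
    exact hb s hs
  have hsP : (s : 𝓞 L) ∉ P := by
    intro hm
    have : (s.natAbs : 𝓞 L) ∈ P := by
      rcases Int.natAbs_eq s with h | h
      · rw [h] at hm; simpa using hm
      · rw [h] at hm; simpa using hm
    exact hdvdB s.natAbs ((Finset.dvd_prod_of_mem _ hs).trans ⟨q * Δ, by simp only [B]; ring⟩) this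
  have hβP : β ∉ P := by
    intro hm
    apply hsP
    rw [← hβ]
    exact P.pow_mem_of_mem hm q hq.pos
  have hqP : (q : 𝓞 L) ∉ P := hdvdB q ⟨Δ * ∏ s ∈ S, s.natAbs, by simp only [B]; ring⟩
  have h1 : β ^ q - (x : 𝓞 L) ^ q ∈ P := by
    obtain ⟨m, hm⟩ := hx
    have : β ^ q - (x : 𝓞 L) ^ q = (p : 𝓞 L) * (-m : 𝓞 L) := by
      rw [hβ]
      have := congrArg (Int.cast : ℤ → 𝓞 L) hm
      push_cast at this
      linear_combination -this
    rw [this]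
    exact P.mul_mem_right _ hpP
  rw [IsPrimitiveRoot.pow_sub_pow_eq_prod_sub_mul _ _ hq.pos hζ', hP.prod_mem_iff] at h1
  obtain ⟨η, hη, hηP⟩ := h1
  rw [Polynomial.mem_nthRootsFinset hq.pos] at hη
  have h2 : σ • β - η * x ∈ P := by
    have := hmemσ _ hηP
    rw [smul_sub, smul_mul', hfixroot σ η hη] at this
    have hx' : σ • (x : 𝓞 L) = x := by
      apply RingOfIntegers.ext
      exact map_intCast σ x
    rwa [hx'] at this
  have h3 : σ • β - β ∈ P := by
    have := P.sub_mem h2 hηP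
    simpa using this
  have h4 : (σ • β) ^ q - β ^ q = 0 := by
    rw [← smul_pow', hβ]
    have hx' : σ • (s : 𝓞 L) = s := by
      apply RingOfIntegers.ext
      exact map_intCast σ s
    rw [hx', sub_self]
  rw [IsPrimitiveRoot.pow_sub_pow_eq_prod_sub_mul _ _ hq.pos hζ', Finset.prod_eq_zero_iff] at h4
  obtain ⟨ω, hω, h5⟩ := h4
  rw [Polynomial.mem_nthRootsFinset hq.pos] at hω
  have h6 : (ω - 1) * β ∈ P := by
    have : (ω - 1) * β = σ • β - β := by linear_combination -h5
    rwa [this]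
  have h7 : ω - 1 ∈ P := (hP.mem_or_mem h6).resolve_right hβP
  have h8 : ω = 1 := by
    by_contra hne
    have hgeom : ∑ i ∈ Finset.range q, ω ^ i = 0 := by
      have := geom_sum_mul ω q
      rw [hω, sub_self] at this
      exact (mul_eq_zero.1 this).resolve_right (sub_ne_zero.2 hne)
    apply hqP
    have : (q : 𝓞 L) = - ∑ i ∈ Finset.range q, (ω ^ i - 1) := by
      rw [Finset.sum_sub_distrib, hgeom]; simp
    rw [this]
    apply P.neg_mem
    apply P.sum_mem
    intro i _
    have := sub_dvd_pow_sub_pow ω 1 i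
    rw [one_pow] at this
    exact P.mem_of_dvd this h7
  have h9 : σ (b s) = b s := by
    have : σ • β = β := by
      rw [h8, one_mul] at h5; exact sub_eq_zero.1 h5
    have := congrArg (algebraMap (𝓞 L) L) this
    exact this
  exact hgs (hkey σ hσ1 _ h9)

end PartB

section PartC
open NumberField Filter Topology

theorem bose_burton (q : ℕ) (hq : q.Prime) {ι α : Type*} [Fintype ι] (v : α → ι → ZMod q) (k : ℕ)
    (B : Finset α) (hv : ∀ a ∈ B, v a ≠ 0)
    (h : ∀ F : Fin k → (ι → ZMod q), ∃ a ∈ B, ∀ i, F i ⬝ᵥ v a = 0) :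
    ∑ i ∈ Finset.range (k + 1), q ^ i ≤ B.card := by
  classical
  have := Fact.mk hq
  induction k generalizing B with
  | zero =>
    obtain ⟨a, ha, -⟩ := h (fun _ => 0)
    simpa using Finset.card_pos.2 ⟨a, ha⟩
  | succ k ih =>
    set θ := ∑ i ∈ Finset.range (k + 1), q ^ i with hθ
    rw [geom_sum_succ, ← hθ]
    have hθpos : 0 < θ := by
      rw [hθ, Finset.sum_range_succ']; simp
    have hstep : ∀ f : ι → ZMod q, θ ≤ (B.filter (fun a => f ⬝ᵥ v a = 0)).card := by
      intro f
      apply ih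
      · intro a ha; exact hv a (Finset.mem_filter.1 ha).1
      · intro F
        obtain ⟨a, ha, hF⟩ := h (Fin.cons f F)
        refine ⟨a, Finset.mem_filter.2 ⟨ha, by simpa using hF 0⟩, fun i => by simpa using hF i.succ⟩
    set Q := Fintype.card (ι → ZMod q) with hQ
    have hC : ∀ a ∈ B, (Finset.univ.filter (fun f : ι → ZMod q => f ⬝ᵥ v a = 0)).card * q ≤ Q := by
      intro a ha
      obtain ⟨i, hi⟩ := Function.ne_iff.1 (hv a ha)
      have hi : v a i ≠ 0 := hi
      let e : ι → ZMod q := Pi.single i (v a i)⁻¹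
      have he : e ⬝ᵥ v a = 1 := by
        simp [e, single_dotProduct, inv_mul_cancel₀ hi]
      have : (Finset.univ.filter (fun f : ι → ZMod q => f ⬝ᵥ v a = 0)).card * q =
        ((Finset.univ.filter (fun f : ι → ZMod q => f ⬝ᵥ v a = 0)) ×ˢ (Finset.univ : Finset (ZMod q))).card := by
        rw [Finset.card_product, Finset.card_univ, ZMod.card]
      rw [this, hQ, ← Finset.card_univ]
      refine Finset.card_le_card_of_injOn (fun x => x.1 + x.2 • e) (fun _ _ => Finset.mem_univ _) ?_
      rintro ⟨f, c⟩ hf ⟨f', c'⟩ hf' heq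
      simp only [Finset.coe_product, Set.mem_prod, Finset.coe_filter, Finset.mem_univ, true_and, Set.mem_ofPred_eq] at hf hf'
      simp only at heq
      have h1 := congrArg (fun w => w ⬝ᵥ v a) heq
      simp only [add_dotProduct, smul_dotProduct, he, hf.1, hf'.1, zero_add, smul_eq_mul, mul_one] at h1
      subst h1
      simpa using heq
    have hdc : ∑ f : ι → ZMod q, (B.filter (fun a => f ⬝ᵥ v a = 0)).card =
        ∑ a ∈ B, (Finset.univ.filter (fun f : ι → ZMod q => f ⬝ᵥ v a = 0)).card := by
      simp only [Finset.card_filter]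
      rw [Finset.sum_comm]
    have hub : (∑ a ∈ B, (Finset.univ.filter (fun f : ι → ZMod q => f ⬝ᵥ v a = 0)).card) * q ≤ B.card * Q := by
      rw [Finset.sum_mul, ← smul_eq_mul, ← Finset.sum_const]
      exact Finset.sum_le_sum hC
    have hlb : B.card + (Q - 1) * θ ≤ ∑ f : ι → ZMod q, (B.filter (fun a => f ⬝ᵥ v a = 0)).card := by
      rw [← Finset.add_sum_erase _ _ (Finset.mem_univ (0 : ι → ZMod q))]
      apply Nat.add_le_add
      · simp
      · have : (Finset.univ.erase (0 : ι → ZMod q)).card = Q - 1 := by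
          rw [Finset.card_erase_of_mem (Finset.mem_univ _), Finset.card_univ]
        rw [← this, ← smul_eq_mul, ← Finset.sum_const]
        exact Finset.sum_le_sum (fun f _ => hstep f)
    obtain ⟨a, ha, -⟩ := h (fun _ => 0)
    have hQq : q ≤ Q := by
      refine le_trans ?_ (hC a ha)
      apply Nat.le_mul_of_pos_left
      exact Finset.card_pos.2 ⟨0, by simp⟩
    rw [hdc] at hlb
    have hfin : (B.card + (Q - 1) * θ) * q ≤ B.card * Q := (Nat.mul_le_mul_right q hlb).trans hub
    by_contra hlt
    have hlt' : B.card ≤ q * θ := by omega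
    have hq2 := hq.two_le
    obtain ⟨d, hd⟩ := Nat.exists_eq_add_of_le hQq
    obtain ⟨r, hr⟩ := Nat.exists_eq_add_of_le hq2
    have hQ1 : Q - 1 = d + r + 1 := by omega
    rw [hQ1, hd] at hfin
    have h1 : B.card * d ≤ q * θ * d := Nat.mul_le_mul_right d hlt'
    have h2 : 0 < θ * q * (r + 1) := by positivity
    nlinarith

/-- power of a root of unity with exponent in `ZMod q`. -/
noncomputable def zpw {L : Type*} [Field L] {q : ℕ} (ζ : L) (a : ZMod q) : L := ζ ^ a.val

lemma zpw_natCast {L : Type*} [Field L] {q : ℕ} {ζ : L} (hζ : ζ ^ q = 1) (n : ℕ) :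
    zpw ζ (n : ZMod q) = ζ ^ n := by
  unfold zpw
  rw [ZMod.val_natCast]
  exact (pow_eq_pow_mod n hζ).symm

lemma zpw_add {L : Type*} [Field L] {q : ℕ} [NeZero q] {ζ : L} (hζ : ζ ^ q = 1) (a b : ZMod q) :
    zpw ζ (a + b) = zpw ζ a * zpw ζ b := by
  have : a + b = ((a.val + b.val : ℕ) : ZMod q) := by simp
  rw [this, zpw_natCast hζ, pow_add]; rfl

lemma zpw_zero {L : Type*} [Field L] {q : ℕ} {ζ : L} : zpw ζ (0 : ZMod q) = 1 := by
  simp [zpw]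

lemma zpw_sum {L : Type*} [Field L] {q : ℕ} [NeZero q] {ζ : L} (hζ : ζ ^ q = 1) {ι : Type*} (s : Finset ι) (f : ι → ZMod q) :
    zpw ζ (∑ i ∈ s, f i) = ∏ i ∈ s, zpw ζ (f i) := by
  classical
  induction s using Finset.induction_on with
  | empty => simp [zpw_zero]
  | insert a s ha ih => rw [Finset.sum_insert ha, Finset.prod_insert ha, zpw_add hζ, ih]

lemma zpw_pow {L : Type*} [Field L] {q : ℕ} [NeZero q] {ζ : L} (hζ : ζ ^ q = 1) (a : ZMod q) (n : ℕ) :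
    zpw ζ a ^ n = zpw ζ (a * (n : ZMod q)) := by
  have : a * (n : ZMod q) = ((a.val * n : ℕ) : ZMod q) := by simp
  rw [this, zpw_natCast hζ, pow_mul]; rfl

lemma zpw_eq_one {L : Type*} [Field L] {q : ℕ} [NeZero q] {ζ : L} (hζ : IsPrimitiveRoot ζ q) (a : ZMod q)
    (h : zpw ζ a = 1) : a = 0 := by
  have h1 := hζ.dvd_of_pow_eq_one a.val h
  have h2 := ZMod.val_lt a
  exact (ZMod.val_eq_zero a).1 (Nat.eq_zero_of_dvd_of_lt h1 h2)

lemma prod_not_pow (q : ℕ) (hq : q.Prime) (P : Finset ℕ) (hP : ∀ p ∈ P, p.Prime) (e : P → ℕ) (p₀ : P)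
    (h0 : ¬ q ∣ e p₀) (r : ℚ) : r ^ q ≠ ((∏ p : P, (p : ℕ) ^ e p : ℕ) : ℚ) := by
  intro h
  have hp0 := Fact.mk (hP p₀ p₀.2)
  set t := ∏ p : P, (p : ℕ) ^ e p with ht
  have ht0 : t ≠ 0 := by
    rw [ht, Finset.prod_ne_zero_iff]
    intro p _
    exact pow_ne_zero _ (hP p p.2).ne_zero
  have hr0 : r ≠ 0 := by
    rintro rfl
    rw [zero_pow hq.ne_zero] at h
    exact ht0 (by exact_mod_cast h.symm)
  have h1 := congrArg (padicValRat p₀) h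
  rw [padicValRat.pow, padicValRat.of_nat] at h1
  have h2 : padicValNat p₀ t = e p₀ := by
    rw [← Nat.factorization_def _ hp0.out, ht, Nat.factorization_prod (fun (p : P) _ => pow_ne_zero _ (hP p.1 p.2).ne_zero)]
    rw [Finsupp.finsetSum_apply, Finset.sum_eq_single p₀]
    · simp [Nat.factorization_pow, hp0.out.factorization]
    · intro p _ hne
      have : (p:ℕ) ≠ p₀ := fun h => hne (Subtype.ext h)
      simp [Nat.factorization_pow, (hP p p.2).factorization, this]
    · simp
  rw [h2] at h1
  apply h0
  have : (q : ℤ) ∣ (e p₀ : ℤ) := ⟨_, h1.symm⟩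
  exact_mod_cast this

open IntermediateField in
theorem kummer_aut {L : Type*} [Field L] [NumberField L] [IsGalois ℚ L] (q : ℕ) (hq : q.Prime)
    (ζ : L) (hζ : IsPrimitiveRoot ζ q) (P : Finset ℕ) (hP : ∀ p ∈ P, p.Prime) (β : P → L)
    (hβ : ∀ p, β p ^ q = (p : ℕ))
    (hgen : ∀ h : Gal(L/ℚ), h ζ = ζ → (∀ p, h (β p) = β p) → h = 1) (f : P → ZMod q) :
    ∃ g : Gal(L/ℚ), g ^ q = 1 ∧ g ζ = ζ ∧ ∀ p, g (β p) = zpw ζ (f p) * β p := by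
  classical
  have := Fact.mk hq
  have hζ1 : ζ ^ q = 1 := hζ.pow_eq_one
  have hβ0 : ∀ p, β p ≠ 0 := by
    intro p h
    have := hβ p
    rw [h, zero_pow hq.ne_zero] at this
    exact (hP p p.2).ne_zero (by exact_mod_cast this.symm)
  have hfixz : ∀ (h : Gal(L/ℚ)), h ζ = ζ → ∀ a : ZMod q, h (zpw ζ a) = zpw ζ a := by
    intro h hh a
    simp [zpw, hh]
  let V : AddSubgroup (P → ZMod q) :=
    { carrier := {v | ∃ g : Gal(L/ℚ), g ζ = ζ ∧ ∀ p, g (β p) = zpw ζ (v p) * β p}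
      zero_mem' := ⟨1, rfl, fun p => by simp [zpw_zero]⟩
      add_mem' := by
        rintro v w ⟨g, hg, hg'⟩ ⟨h, hh, hh'⟩
        refine ⟨g * h, by rw [AlgEquiv.mul_apply, hh, hg], fun p => ?_⟩
        rw [AlgEquiv.mul_apply, hh', map_mul, hfixz g hg, hg', Pi.add_apply, zpw_add hζ1]
        ring
      neg_mem' := by
        rintro v ⟨g, hg, hg'⟩
        have hg2 : g⁻¹ ζ = ζ := by
          conv_lhs => rw [← hg]
          exact AlgEquiv.symm_apply_apply g ζ
        refine ⟨g⁻¹, hg2, fun p => ?_⟩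
        have h1 : β p = zpw ζ (v p) * g⁻¹ (β p) := by
          have := congrArg (g⁻¹ : Gal(L/ℚ)) (hg' p)
          rw [map_mul, hfixz _ hg2] at this
          rw [← this]
          exact (AlgEquiv.symm_apply_apply g (β p)).symm
        conv_rhs => rw [h1]
        rw [← mul_assoc, ← zpw_add hζ1]
        simp [zpw_zero] }
  suffices hV : V = ⊤ by
    have hf : f ∈ V := by rw [hV]; trivial
    obtain ⟨g, hg, hg'⟩ := hf
    refine ⟨g, ?_, hg, hg'⟩
    have hpow : ∀ n : ℕ, (g ^ n) ζ = ζ ∧ ∀ p, (g ^ n) (β p) = zpw ζ (f p) ^ n * β p := by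
      intro n
      induction n with
      | zero => simp
      | succ n ih =>
        rw [pow_succ]
        refine ⟨by rw [AlgEquiv.mul_apply, hg, ih.1], fun p => ?_⟩
        rw [AlgEquiv.mul_apply, hg', map_mul, hfixz _ ih.1, ih.2]
        ring
    refine hgen _ (hpow q).1 (fun p => ?_)
    rw [(hpow q).2, zpw_pow hζ1]
    simp [zpw_zero]
  by_contra hne
  let V' : Submodule (ZMod q) (P → ZMod q) := AddSubgroup.toZModSubmodule q V
  have hV' : V' < ⊤ := by
    rw [lt_top_iff_ne_top]
    intro h
    apply hne
    rw [eq_top_iff]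
    intro x _
    have : x ∈ V' := by rw [h]; trivial
    exact this
  obtain ⟨φ, hφ0, hφ⟩ := Submodule.exists_le_ker_of_lt_top V' hV'
  let b : P → ZMod q := fun p => φ (Pi.single p 1)
  have hφb : ∀ v, φ v = ∑ p, v p * b p := by
    intro v
    rw [LinearMap.pi_apply_eq_sum_univ φ v]
    refine Finset.sum_congr rfl fun p _ => ?_
    rw [smul_eq_mul]
    congr 2
    ext j
    simp [Pi.single_apply, eq_comm]
  obtain ⟨p₀, hp₀⟩ : ∃ p, b p ≠ 0 := by
    by_contra hall
    push Not at hall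
    apply hφ0
    refine LinearMap.ext fun v => ?_
    simp [hφb, hall]
  let γ : L := ∏ p, β p ^ (b p).val
  have hγfix : ∀ h : Gal(L/ℚ), h ζ = ζ → h γ = γ := by
    intro h hh
    have hex : ∀ p, ∃ a : ZMod q, h (β p) = zpw ζ a * β p := by
      intro p
      have h1 : (h (β p) / β p) ^ q = 1 := by
        rw [div_pow, ← map_pow, hβ, map_natCast, div_self]
        exact_mod_cast (hP p p.2).ne_zero
      obtain ⟨i, -, hi⟩ := hζ.eq_pow_of_pow_eq_one h1
      refine ⟨i, ?_⟩
      rw [zpw_natCast hζ1, hi, div_mul_cancel₀ _ (hβ0 p)]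
    choose v hv using hex
    have hvV : v ∈ V' := ⟨h, hh, hv⟩
    have hzero : ∑ p, v p * b p = 0 := by
      rw [← hφb]; exact hφ hvV
    simp only [γ, map_prod, map_pow, hv, mul_pow, Finset.prod_mul_distrib]
    have : ∏ p, zpw ζ (v p) ^ (b p).val = 1 := by
      rw [← zpw_zero (ζ := ζ) (q := q), ← hzero, zpw_sum hζ1]
      refine Finset.prod_congr rfl fun p _ => ?_
      rw [zpw_pow hζ1]; simp
    rw [this, one_mul]
  have hγK : γ ∈ ℚ⟮ζ⟯ := by
    rw [← IsGalois.fixedField_fixingSubgroup ℚ⟮ζ⟯, mem_fixedField_iff]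
    intro h hh
    apply hγfix
    rw [IntermediateField.mem_fixingSubgroup_iff] at hh
    exact hh ζ (mem_adjoin_simple_self ℚ ζ)
  let t : ℕ := ∏ p : P, (p : ℕ) ^ (b p).val
  have hγq : γ ^ q = (t : L) := by
    simp only [γ, t, ← Finset.prod_pow]
    push_cast
    refine Finset.prod_congr rfl fun p _ => ?_
    rw [← hβ, pow_right_comm]
  have hnp : ∀ r : ℚ, r ^ q ≠ (t : ℚ) := by
    intro r
    refine prod_not_pow q hq P hP (fun p => (b p).val) p₀ ?_ r
    intro hd
    exact hp₀ ((ZMod.val_eq_zero _).1 (Nat.eq_zero_of_dvd_of_lt hd (ZMod.val_lt _)))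
  have hirr : Irreducible (Polynomial.X ^ q - Polynomial.C (t : ℚ)) :=
    X_pow_sub_C_irreducible_of_prime hq hnp
  let γ' : ℚ⟮ζ⟯ := ⟨γ, hγK⟩
  have hmin : minpoly ℚ γ' = Polynomial.X ^ q - Polynomial.C (t : ℚ) := by
    refine (minpoly.eq_of_irreducible_of_monic hirr ?_ (Polynomial.monic_X_pow_sub_C _ hq.ne_zero)).symm
    apply Subtype.ext
    simpa [γ', sub_eq_zero] using hγq
  have hdeg := minpoly.natDegree_le (A := ℚ) γ'
  rw [hmin, Polynomial.natDegree_X_pow_sub_C, adjoin.finrank (Algebra.IsIntegral.isIntegral ζ),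
    ← Polynomial.cyclotomic_eq_minpoly_rat hζ hq.pos, Polynomial.natDegree_cyclotomic,
    Nat.totient_prime hq] at hdeg
  have := hq.two_le
  omega

end PartC

open Polynomial in
theorem exists_splitting_field (f : ℚ[X]) :
    ∃ (L : Type) (_ : Field L) (_ : CharZero L), IsSplittingField ℚ L f := by
  have hc : CharZero f.SplittingField :=
    charZero_of_injective_algebraMap (algebraMap ℚ f.SplittingField).injective
  refine ⟨f.SplittingField, inferInstance, hc, ?_⟩
  have h : IsSplittingField ℚ f.SplittingField f := Polynomial.IsSplittingField.splittingField f
  convert h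

open Polynomial in
theorem exists_kummer_field (q : ℕ) (hq : q.Prime) (P : Finset ℕ) (hP : ∀ p ∈ P, p.Prime) :
    ∃ (L : Type) (_ : Field L) (_ : NumberField L) (_ : IsGalois ℚ L) (ζ : L) (β : P → L),
      IsPrimitiveRoot ζ q ∧ (∀ p, β p ^ q = (p : ℕ)) ∧
      (∀ h : Gal(L/ℚ), h ζ = ζ → (∀ p, h (β p) = β p) → h = 1) := by
  classical
  let f : ℚ[X] := (X ^ q - C 1) * ∏ p : P, (X ^ q - C ((p : ℕ) : ℚ))
  obtain ⟨L, iF, iC, iS⟩ := exists_splitting_field f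
  have hfd : FiniteDimensional ℚ L := IsSplittingField.finiteDimensional L f
  have hNF : NumberField L := { to_charZero := iC, to_finiteDimensional := hfd }
  have hnorm : Normal ℚ L := Normal.of_isSplittingField f
  have hgal : IsGalois ℚ L := IsGalois.mk
  have hf1 : (X ^ q - C 1 : ℚ[X]) ≠ 0 := X_pow_sub_C_ne_zero hq.pos _
  have hf2 : ∀ p : P, (X ^ q - C ((p : ℕ) : ℚ) : ℚ[X]) ≠ 0 := fun p => X_pow_sub_C_ne_zero hq.pos _
  have hf0 : f ≠ 0 := mul_ne_zero hf1 (Finset.prod_ne_zero_iff.2 fun p _ => hf2 p)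
  have hsp : (f.map (algebraMap ℚ L)).Splits := IsSplittingField.splits L f
  have hroot : ∀ a : ℚ, (X ^ q - C a) ∣ f → ∃ r : L, r ^ q = algebraMap ℚ L a := by
    intro a ha
    have hs : ((X ^ q - C a).map (algebraMap ℚ L)).Splits :=
      hsp.of_dvd (by rwa [Ne, Polynomial.map_eq_zero]) (Polynomial.map_dvd _ ha)
    obtain ⟨r, hr⟩ := hs.exists_eval_eq_zero (by
      rw [degree_map, degree_X_pow_sub_C hq.pos]; exact_mod_cast hq.ne_zero)
    refine ⟨r, ?_⟩
    simpa [sub_eq_zero] using hr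
  have hdv : ∀ p : P, (X ^ q - C ((p : ℕ) : ℚ)) ∣ f := by
    intro p
    apply dvd_mul_of_dvd_right
    exact Finset.dvd_prod_of_mem (fun p : P => (X ^ q - C ((p : ℕ) : ℚ) : ℚ[X])) (Finset.mem_univ p)
  have hdv1 : (X ^ q - C 1) ∣ f := dvd_mul_right _ _
  have hβ : ∀ p : P, ∃ r : L, r ^ q = ((p : ℕ) : L) := by
    intro p
    obtain ⟨r, hr⟩ := hroot (p : ℕ) (hdv p)
    exact ⟨r, by simpa using hr⟩
  choose β hβ using hβ
  obtain ⟨ζ, hζ⟩ : ∃ ζ : L, IsPrimitiveRoot ζ q := by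
    have hd : cyclotomic q ℚ ∣ f := by
      refine (cyclotomic.dvd_X_pow_sub_one q ℚ).trans ?_
      rw [← C_1]
      exact hdv1
    have hs : ((cyclotomic q ℚ).map (algebraMap ℚ L)).Splits :=
      hsp.of_dvd (by rwa [Ne, Polynomial.map_eq_zero]) (Polynomial.map_dvd _ hd)
    obtain ⟨r, hr⟩ := hs.exists_eval_eq_zero (by
      rw [degree_map, degree_cyclotomic]
      have := Nat.totient_pos.2 hq.pos
      exact_mod_cast this.ne')
    refine ⟨r, ?_⟩
    rw [map_cyclotomic] at hr
    have : NeZero (q : L) := ⟨by exact_mod_cast hq.ne_zero⟩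
    exact isRoot_cyclotomic_iff.1 hr
  refine ⟨L, inferInstance, hNF, hgal, ζ, β, hζ, hβ, ?_⟩
  intro h hhζ hhβ
  have hqz : NeZero q := ⟨hq.ne_zero⟩
  have key : ∀ x ∈ f.rootSet L, h x = x := by
    intro x hx
    rw [mem_rootSet] at hx
    have hx := hx.2
    simp only [f, map_mul, map_prod, mul_eq_zero, Finset.prod_eq_zero_iff] at hx
    rcases hx with hx | ⟨p, -, hx⟩
    · have hx : x ^ q = 1 := by simpa [sub_eq_zero] using hx
      obtain ⟨i, -, rfl⟩ := hζ.eq_pow_of_pow_eq_one hx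
      rw [map_pow, hhζ]
    · have hx : x ^ q = ((p : ℕ) : L) := by simpa [sub_eq_zero] using hx
      have hp0 : ((p : ℕ) : L) ≠ 0 := by exact_mod_cast (hP p p.2).ne_zero
      have hb0 : β p ≠ 0 := by
        intro hb
        have := hβ p
        rw [hb, zero_pow hq.ne_zero] at this
        exact hp0 this.symm
      have h1 : (x / β p) ^ q = 1 := by rw [div_pow, hx, hβ, div_self hp0]
      obtain ⟨i, -, hi⟩ := hζ.eq_pow_of_pow_eq_one h1
      have : x = ζ ^ i * β p := by rw [hi, div_mul_cancel₀ _ hb0]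
      rw [this, map_mul, map_pow, hhζ, hhβ]
  have hle : Algebra.adjoin ℚ (f.rootSet L) ≤ AlgHom.equalizer (h : L →ₐ[ℚ] L) (AlgHom.id ℚ L) :=
    Algebra.adjoin_le key
  rw [IsSplittingField.adjoin_rootSet L f] at hle
  ext x
  exact hle (Algebra.mem_top (x := x))

lemma natAbs_prod (P : Finset ℕ) (n : ℕ) (hn : n ≠ 0) (hP : n.primeFactors ⊆ P) :
    ∏ p : P, (p : ℕ) ^ n.factorization p = n := by
  rw [Finset.prod_coe_sort P (fun p => p ^ n.factorization p)]
  conv_rhs => rw [← Nat.prod_factorization_pow_eq_self hn]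
  rw [Finsupp.prod_of_support_subset _ (by simpa using hP)]
  simp

theorem key_prime (q : ℕ) (hq : q.Prime) (hodd : Odd q) (P : Finset ℕ) (hP : ∀ p ∈ P, p.Prime)
    (S : Finset ℤ) (h0 : ∀ s ∈ S, s ≠ 0) (hSP : ∀ s ∈ S, s.natAbs.primeFactors ⊆ P)
    (Δ : ℕ) (hΔ : Δ ≠ 0) (f : P → ZMod q) :
    ∃ l : ℕ, l.Prime ∧ ¬ l ∣ Δ ∧ ∀ s ∈ S, (∃ x : ℤ, (l : ℤ) ∣ x ^ q - s) →
      f ⬝ᵥ (fun p : P => (s.natAbs.factorization p : ZMod q)) = 0 := by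
  have := Fact.mk hq
  obtain ⟨L, _, _, _, ζ, β, hζ, hβ, hgen⟩ := exists_kummer_field q hq P hP
  have hζ1 : ζ ^ q = 1 := hζ.pow_eq_one
  obtain ⟨g, hgq, hgζ, hgβ⟩ := kummer_aut q hq ζ hζ P hP β hβ hgen f
  let b : ℤ → L := fun s => (s.sign : L) * ∏ p : P, β p ^ s.natAbs.factorization p
  have hb : ∀ s ∈ S, b s ^ q = s := by
    intro s hs
    have h1 : (s.sign : ℤ) ^ q = s.sign := by
      rcases lt_or_gt_of_ne (h0 s hs) with h | h
      · rw [Int.sign_eq_neg_one_of_neg h, hodd.neg_one_pow]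
      · rw [Int.sign_eq_one_of_pos h, one_pow]
    have h2 : ∏ p : P, (β p ^ s.natAbs.factorization p) ^ q = (s.natAbs : L) := by
      have := natAbs_prod P s.natAbs (by simpa using h0 s hs) (hSP s hs)
      conv_rhs => rw [← this]
      push_cast
      refine Finset.prod_congr rfl fun p _ => ?_
      rw [pow_right_comm, hβ]
    simp only [b]
    rw [mul_pow, ← Finset.prod_pow, h2]
    have h3 := Int.sign_mul_natAbs s
    have h4 := congrArg (Int.cast : ℤ → L) h3
    have h5 := congrArg (Int.cast : ℤ → L) h1
    push_cast at h4 h5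
    rw [h5]
    simpa using h4
  obtain ⟨l, hl, hlΔ, hls⟩ := kummer_prime q hq g hgq ζ hζ hgζ S h0 b hb Δ hΔ
  refine ⟨l, hl, hlΔ, fun s hs hx => ?_⟩
  have h1 := hls s hs hx
  have hb0 : b s ≠ 0 := by
    intro h
    have := hb s hs
    rw [h, zero_pow hq.ne_zero] at this
    exact h0 s hs (by exact_mod_cast this.symm)
  have h2 : g (b s) = zpw ζ (f ⬝ᵥ (fun p : P => (s.natAbs.factorization p : ZMod q))) * b s := by
    simp only [b, map_mul, map_prod, map_pow, hgβ, mul_pow, Finset.prod_mul_distrib, map_intCast]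
    rw [dotProduct, zpw_sum hζ1]
    simp only [zpw_pow hζ1]
    ring
  rw [h1] at h2
  apply zpw_eq_one hζ
  exact (mul_right_cancel₀ hb0 (by rw [one_mul]; exact h2)).symm

lemma perfect_of_dvd (q : ℕ) (hodd : Odd q) (s : ℤ) (h0 : s ≠ 0)
    (h : ∀ p ∈ s.natAbs.primeFactors, q ∣ s.natAbs.factorization p) : IsPerfectPow q s := by
  have hn : s.natAbs ≠ 0 := by simpa using h0
  have h1 : (∏ p ∈ s.natAbs.primeFactors, p ^ (s.natAbs.factorization p / q)) ^ q = s.natAbs := by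
    conv_rhs => rw [← Nat.prod_factorization_pow_eq_self hn]
    rw [← Finset.prod_pow, Finsupp.prod, Nat.support_factorization]
    refine Finset.prod_congr rfl fun p hp => ?_
    rw [← pow_mul, Nat.div_mul_cancel (h p hp)]
  set m := ∏ p ∈ s.natAbs.primeFactors, p ^ (s.natAbs.factorization p / q)
  have h2 : (m : ℤ) ^ q = (s.natAbs : ℤ) := by exact_mod_cast h1
  rcases Int.natAbs_eq s with h | h
  · exact ⟨m, by rw [h2]; exact h.symm⟩
  · exact ⟨-m, by rw [hodd.neg_pow, h2]; exact h.symm⟩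

/-- **Proposition (lower bound).** If `S ∈ 𝒯_{k,q}` contains no perfect `q`-th power, then
`|S| ≥ (q^{k+1} - 1)/(q - 1) = q^k + q^{k-1} + ⋯ + q + 1`. -/
theorem stmt8 (q k : ℕ) (hq : q.Prime) (hodd : Odd q) (hk : 1 ≤ k)
    (S : Finset ℤ) (hSpow : ∀ s ∈ S, ¬ IsPerfectPow q s)
    (hS : MemT q k ↑S) :
    (∑ i ∈ Finset.range (k + 1), q ^ i) ≤ S.card := by
  classical
  obtain ⟨Δ, hΔ, hS⟩ := hS
  have h0 : ∀ s ∈ S, s ≠ 0 := by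
    rintro s hs rfl
    exact hSpow 0 hs ⟨0, zero_pow hq.ne_zero⟩
  let P : Finset ℕ := S.biUnion fun s => s.natAbs.primeFactors
  have hP : ∀ p ∈ P, p.Prime := by
    intro p hp
    obtain ⟨s, -, hps⟩ := Finset.mem_biUnion.1 hp
    exact Nat.prime_of_mem_primeFactors hps
  have hSP : ∀ s ∈ S, s.natAbs.primeFactors ⊆ P := fun s hs =>
    Finset.subset_biUnion_of_mem (fun s : ℤ => s.natAbs.primeFactors) hs
  refine bose_burton q hq (fun (s : ℤ) (p : P) => (s.natAbs.factorization p : ZMod q)) k S ?_ ?_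
  · intro s hs hv
    apply hSpow s hs
    refine perfect_of_dvd q hodd s (h0 s hs) fun p hp => ?_
    have := congrFun hv ⟨p, hSP s hs hp⟩
    exact (ZMod.natCast_eq_zero_iff _ _).1 this
  · intro F
    have hk := fun i => key_prime q hq hodd P hP S h0 hSP Δ hΔ.ne' (F i)
    choose l hl hlΔ hls using hk
    have hlen : ∀ t : Finset (Fin k), (∏ i ∈ t, l i).primeFactorsList.length ≤ t.card := by
      intro t
      induction t using Finset.induction_on with
      | empty => simp
      | insert a t ha ih =>
        rw [Finset.prod_insert ha, Finset.card_insert_of_notMem ha]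
        have hne : ∏ i ∈ t, l i ≠ 0 := Finset.prod_ne_zero_iff.2 fun i _ => (hl i).ne_zero
        rw [(Nat.perm_primeFactorsList_mul (hl a).ne_zero hne).length_eq, List.length_append,
          Nat.primeFactorsList_prime (hl a)]
        simp only [List.length_singleton]
        omega
    obtain ⟨s, hs, x, hx⟩ := hS (∏ i, l i) (Finset.prod_pos fun i _ => (hl i).pos)
      (by simpa using hlen Finset.univ)
      (Nat.Coprime.prod_left fun i _ => ((hl i).coprime_iff_not_dvd).2 (hlΔ i))
    refine ⟨s, hs, fun i => hls i s hs ⟨x, ?_⟩⟩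
    refine dvd_trans ?_ hx
    exact_mod_cast Finset.dvd_prod_of_mem l (Finset.mem_univ i)
end

section
/- Let q be an odd prime and k ≥ 1 a natural number. Let S be a finite set of integers with |S| ≤ q^k + q^{k−1} + … + q (i.e., |S| ≤ (q^{k+1} − 1)/(q − 1) − 1). Then S belongs to 𝒯_{k,q} if and only if S contains a perfect q-th power. -/
open Finset

noncomputable def idealCount (F : Type) [Field F] [NumberField F] (n : ℕ) : ℕ :=
  Nat.card {I : Ideal (NumberField.RingOfIntegers F) // Ideal.absNorm I = n}

section P1
variable (F : Type) [Field F] [NumberField F]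
open NumberField UniqueFactorizationMonoid

lemma idealCount_one : idealCount F 1 = 1 := by
  unfold idealCount
  simp [Ideal.absNorm_eq_one_iff]

lemma gcd_aux {I : Ideal (𝓞 F)} {m n : ℕ} (h : Nat.Coprime m n) (hI : ((m * n : ℕ) : 𝓞 F) ∈ I) :
    (I ⊔ Ideal.span {(m : 𝓞 F)}) * (I ⊔ Ideal.span {(n : 𝓞 F)}) = I := by
  apply le_antisymm
  · rw [Ideal.sup_mul, Ideal.mul_sup, Ideal.mul_sup]
    refine sup_le (sup_le Ideal.mul_le_left Ideal.mul_le_left) (sup_le Ideal.mul_le_right ?_)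
    rw [Ideal.span_singleton_mul_span_singleton, Ideal.span_singleton_le_iff_mem]
    exact_mod_cast hI
  · have hc : IsCoprime (m : 𝓞 F) (n : 𝓞 F) := by
      simpa using (Nat.isCoprime_iff_coprime.mpr h).map (Int.castRingHom (𝓞 F))
    obtain ⟨a, b, hab⟩ := hc
    intro x hx
    have : x = (a * m) * x + x * (b * n) := by linear_combination (-x) * hab
    rw [this]
    refine add_mem ?_ ?_
    · exact Ideal.mul_mem_mul (Ideal.mem_sup_right (Ideal.mul_mem_left _ _ (Ideal.mem_span_singleton_self _))) (Ideal.mem_sup_left hx)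
    · exact Ideal.mul_mem_mul (Ideal.mem_sup_left hx) (Ideal.mem_sup_right (Ideal.mul_mem_left _ _ (Ideal.mem_span_singleton_self _)))

lemma gcd_aux2 {J K : Ideal (𝓞 F)} {m n : ℕ} (h : Nat.Coprime m n) (hJ : (m : 𝓞 F) ∈ J)
    (hK : (n : 𝓞 F) ∈ K) : J * K ⊔ Ideal.span {(m : 𝓞 F)} = J := by
  apply le_antisymm
  · exact sup_le Ideal.mul_le_left ((Ideal.span_singleton_le_iff_mem _).2 hJ)
  · have hc : IsCoprime (m : 𝓞 F) (n : 𝓞 F) := by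
      simpa using (Nat.isCoprime_iff_coprime.mpr h).map (Int.castRingHom (𝓞 F))
    obtain ⟨a, b, hab⟩ := hc
    intro x hx
    have : x = x * (b * n) + (x * a) * m := by linear_combination (-x) * hab
    rw [this]
    refine add_mem ?_ ?_
    · exact Ideal.mem_sup_left (Ideal.mul_mem_mul hx (Ideal.mul_mem_left _ _ hK))
    · exact Ideal.mem_sup_right (Ideal.mul_mem_left _ _ (Ideal.mem_span_singleton_self _))

lemma absNorm_natCast (m : ℕ) :
    Ideal.absNorm (Ideal.span {(m : 𝓞 F)}) = m ^ Module.finrank ℚ F := by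
  rw [Ideal.absNorm_span_singleton, ← RingOfIntegers.rank F, Algebra.norm_natCast]
  simp

lemma absNorm_sup_dvd (I : Ideal (𝓞 F)) (m : ℕ) :
    Ideal.absNorm (I ⊔ Ideal.span {(m : 𝓞 F)}) ∣ m ^ Module.finrank ℚ F := by
  rw [← absNorm_natCast]
  exact Ideal.absNorm_dvd_absNorm_of_le le_sup_right

lemma idealCount_mul {m n : ℕ} (h : Nat.Coprime m n) :
    idealCount F (m * n) = idealCount F m * idealCount F n := by
  unfold idealCount
  rw [← Nat.card_prod]
  symm
  refine Nat.card_congr (Equiv.ofBijective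
    (fun x => ⟨x.1.1 * x.2.1, by rw [map_mul, x.1.2, x.2.2]⟩) ⟨?_, ?_⟩)
  · rintro ⟨⟨J, hJ⟩, ⟨K, hK⟩⟩ ⟨⟨J', hJ'⟩, ⟨K', hK'⟩⟩ he
    simp only [Subtype.mk.injEq] at he
    have e1 : (m : 𝓞 F) ∈ J := hJ ▸ Ideal.absNorm_mem J
    have e2 : (m : 𝓞 F) ∈ J' := hJ' ▸ Ideal.absNorm_mem J'
    have e3 : (n : 𝓞 F) ∈ K := hK ▸ Ideal.absNorm_mem K
    have e4 : (n : 𝓞 F) ∈ K' := hK' ▸ Ideal.absNorm_mem K'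
    have a1 := gcd_aux2 F h e1 e3
    have a2 := gcd_aux2 F h e2 e4
    have a3 := gcd_aux2 F h.symm e3 e1
    have a4 := gcd_aux2 F h.symm e4 e2
    rw [mul_comm] at a3 a4
    simp only [Prod.mk.injEq, Subtype.mk.injEq]
    exact ⟨by rw [← a1, ← a2, he], by rw [← a3, ← a4, he]⟩
  · rintro ⟨I, hI⟩
    have hm : ((m * n : ℕ) : 𝓞 F) ∈ I := hI ▸ Ideal.absNorm_mem I
    have hg := gcd_aux F h hm
    have hN := congrArg Ideal.absNorm hg
    rw [map_mul, hI] at hN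
    have d1 := absNorm_sup_dvd F I m
    have d2 := absNorm_sup_dvd F I n
    set A := Ideal.absNorm (I ⊔ Ideal.span {(m : 𝓞 F)})
    set B := Ideal.absNorm (I ⊔ Ideal.span {(n : 𝓞 F)})
    have c1 : Nat.Coprime A n := Nat.Coprime.coprime_dvd_left d1 (h.pow_left _)
    have c2 : Nat.Coprime B m := Nat.Coprime.coprime_dvd_left d2 (h.symm.pow_left _)
    have k1 : A ∣ m := c1.dvd_of_dvd_mul_right (hN ▸ dvd_mul_right A B)
    have k2 : B ∣ n := c2.dvd_of_dvd_mul_left (hN ▸ dvd_mul_left B A)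
    have k3 : m ∣ A := c2.symm.dvd_of_dvd_mul_right (hN ▸ dvd_mul_right m n)
    have k4 : n ∣ B := c1.symm.dvd_of_dvd_mul_left (hN ▸ dvd_mul_left n m)
    exact ⟨(⟨_, Nat.dvd_antisymm k1 k3⟩, ⟨_, Nat.dvd_antisymm k2 k4⟩), Subtype.ext hg⟩

lemma card_factors_le {p : ℕ} (hp : p.Prime) :
    (normalizedFactors (Ideal.span {(p : 𝓞 F)})).toFinset.card ≤ Module.finrank ℚ F := by
  classical
  set M := normalizedFactors (Ideal.span {(p : 𝓞 F)})
  have h0 : Ideal.span {(p : 𝓞 F)} ≠ ⊥ := by simp [hp.ne_zero]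
  have h1 : (M.map Ideal.absNorm).prod = p ^ Module.finrank ℚ F := by
    rw [← absNorm_natCast, ← map_multiset_prod]
    congr 1
    exact Ideal.prod_normalizedFactors_eq_self h0
  have h2 : ∀ P ∈ M, p ≤ Ideal.absNorm P := by
    intro P hP
    have hd : Ideal.absNorm P ∣ p ^ Module.finrank ℚ F := by
      rw [← absNorm_natCast]
      exact map_dvd _ (dvd_of_mem_normalizedFactors hP)
    obtain ⟨j, -, hj⟩ := (Nat.dvd_prime_pow hp).1 hd
    have hj0 : j ≠ 0 := by
      rintro rfl
      rw [pow_zero, Ideal.absNorm_eq_one_iff] at hj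
      exact (prime_of_normalized_factor P hP).not_isUnit (by simp [hj])
    rw [hj]
    exact Nat.le_self_pow hj0 p
  have h3 : p ^ M.card ≤ (M.map Ideal.absNorm).prod := by
    rw [← Multiset.card_map (Ideal.absNorm : Ideal (𝓞 F) → ℕ)]
    apply Multiset.pow_card_le_prod
    intro x hx
    obtain ⟨P, hP, rfl⟩ := Multiset.mem_map.1 hx
    exact h2 P hP
  rw [h1] at h3
  exact (Multiset.toFinset_card_le M).trans ((Nat.pow_le_pow_iff_right hp.one_lt).1 h3)

lemma idealCount_prime_pow_le {p : ℕ} (hp : p.Prime) (k : ℕ) :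
    idealCount F (p ^ k) ≤ (k + 1) ^ Module.finrank ℚ F := by
  classical
  set M := normalizedFactors (Ideal.span {(p : 𝓞 F)}) with hM
  have h0 : Ideal.span {(p : 𝓞 F)} ≠ ⊥ := by simp [hp.ne_zero]
  have hlt : ∀ I : {I : Ideal (𝓞 F) // Ideal.absNorm I = p ^ k}, ∀ P ∈ M,
      (normalizedFactors I.1).count P < k + 1 := by
    rintro ⟨I, hI⟩ P hP
    have hI0 : I ≠ ⊥ := by
      rintro rfl
      simp at hI
      exact (pow_ne_zero _ hp.ne_zero) hI.symm
    have hPp := prime_of_normalized_factor P hP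
    by_contra hcon
    push Not at hcon
    have hd : P ^ (k+1) ∣ I := by
      rw [← Ideal.prod_normalizedFactors_eq_self hI0, ← Multiset.prod_replicate]
      exact Multiset.prod_dvd_prod_of_le (Multiset.le_count_iff_replicate_le.1 hcon)
    have hd2 := map_dvd Ideal.absNorm hd
    rw [map_pow, hI] at hd2
    have hd3 : Ideal.absNorm P ∣ p ^ k := (dvd_pow_self _ (by omega)).trans hd2
    obtain ⟨j, -, hj⟩ := (Nat.dvd_prime_pow hp).1 hd3
    have hj0 : j ≠ 0 := by
      rintro rfl
      rw [pow_zero, Ideal.absNorm_eq_one_iff] at hj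
      exact hPp.not_isUnit (by simp [hj])
    rw [hj, ← pow_mul, Nat.pow_dvd_pow_iff_le_right hp.one_lt] at hd2
    have : 1 * (k+1) ≤ j * (k+1) := Nat.mul_le_mul_right _ (by omega)
    omega
  let φ : {I : Ideal (𝓞 F) // Ideal.absNorm I = p ^ k} → (M.toFinset → Fin (k+1)) :=
    fun I P => ⟨(normalizedFactors I.1).count P.1, hlt I P.1 (Multiset.mem_toFinset.1 P.2)⟩
  have hφ : Function.Injective φ := by
    rintro ⟨I, hI⟩ ⟨J, hJ⟩ he
    have key : ∀ I : Ideal (𝓞 F), Ideal.absNorm I = p ^ k → I ≠ ⊥ ∧ ∀ P ∈ normalizedFactors I, P ∈ M := by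
      intro I hI
      have hI0 : I ≠ ⊥ := by
        rintro rfl
        simp at hI
        exact (pow_ne_zero _ hp.ne_zero) hI.symm
      refine ⟨hI0, fun P hP => ?_⟩
      have hPp := prime_of_normalized_factor P hP
      have h1 : P ∣ Ideal.span {(p : 𝓞 F)} := by
        apply hPp.dvd_of_dvd_pow (n := k)
        refine (dvd_of_mem_normalizedFactors hP).trans ?_
        rw [Ideal.dvd_iff_le, Ideal.span_singleton_pow, Ideal.span_singleton_le_iff_mem]
        exact_mod_cast hI ▸ Ideal.absNorm_mem I
      obtain ⟨Q, hQ, hPQ⟩ := exists_mem_normalizedFactors_of_dvd h0 hPp.irreducible h1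
      rw [associated_iff_eq.1 hPQ]
      exact hQ
    obtain ⟨hI0, hI1⟩ := key I hI
    obtain ⟨hJ0, hJ1⟩ := key J hJ
    apply Subtype.ext
    change I = J
    rw [← Ideal.prod_normalizedFactors_eq_self hI0, ← Ideal.prod_normalizedFactors_eq_self hJ0]
    congr 1
    ext P
    by_cases hP : P ∈ M
    · have := congrFun he ⟨P, Multiset.mem_toFinset.2 hP⟩
      simpa [φ] using this
    · rw [Multiset.count_eq_zero_of_notMem (fun h => hP (hI1 P h)),
        Multiset.count_eq_zero_of_notMem (fun h => hP (hJ1 P h))]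
  have := Nat.card_le_card_of_injective φ hφ
  unfold idealCount
  refine this.trans ?_
  rw [Nat.card_eq_fintype_card, Fintype.card_fun, Fintype.card_fin, Fintype.card_coe]
  exact Nat.pow_le_pow_right (by omega) (card_factors_le F hp)

end P1


/-- `g` has Dirichlet mean `c` over the primes. -/
def HasDens (g : Nat.Primes → ℝ) (c : ℝ) : Prop :=
  (∃ B : ℝ, ∀ p, |g p| ≤ B) ∧
  Filter.Tendsto (fun s : ℝ => (∑' p : Nat.Primes, g p * (p : ℝ) ^ (-s)) / Real.log (1 / (s - 1)))
    (nhdsWithin 1 (Set.Ioi 1)) (nhds c)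

section P2
open Filter Topology

lemma tendsto_L : Tendsto (fun s : ℝ => Real.log (1 / (s - 1))) (𝓝[>] 1) atTop := by
  refine Real.tendsto_log_atTop.comp ?_
  simp only [one_div]
  refine tendsto_inv_nhdsGT_zero.comp ?_
  refine tendsto_nhdsWithin_iff.2 ⟨?_, ?_⟩
  · have : Tendsto (fun s : ℝ => s - 1) (𝓝 1) (𝓝 (1 - 1)) := by
      exact (continuous_id.sub continuous_const).tendsto 1
    rw [sub_self] at this
    exact this.mono_left nhdsWithin_le_nhds
  · filter_upwards [self_mem_nhdsWithin] with s hs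
    simpa using hs

lemma summable_bdd {g : Nat.Primes → ℝ} (h : ∃ B : ℝ, ∀ p, |g p| ≤ B) {s : ℝ} (hs : 1 < s) :
    Summable (fun p : Nat.Primes => g p * (p : ℝ) ^ (-s)) := by
  obtain ⟨B, hB⟩ := h
  have h1 : Summable (fun p : Nat.Primes => B * (p : ℝ) ^ (-s)) :=
    (Nat.Primes.summable_rpow.2 (by linarith)).mul_left B
  refine Summable.of_norm_bounded h1 fun p => ?_
  rw [norm_mul, Real.norm_eq_abs, Real.norm_eq_abs, abs_of_nonneg (by positivity : 0 ≤ (p:ℝ)^(-s))]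
  exact mul_le_mul_of_nonneg_right (hB p) (by positivity)

lemma HasDens.add {g h : Nat.Primes → ℝ} {c d : ℝ} (hg : HasDens g c) (hh : HasDens h d) :
    HasDens (fun p => g p + h p) (c + d) := by
  obtain ⟨⟨B, hB⟩, h1⟩ := hg
  obtain ⟨⟨D, hD⟩, h2⟩ := hh
  refine ⟨⟨B + D, fun p => (abs_add_le _ _).trans (add_le_add (hB p) (hD p))⟩, ?_⟩
  refine (h1.add h2).congr' ?_
  filter_upwards [self_mem_nhdsWithin] with s hs
  rw [← add_div, ← (summable_bdd ⟨B, hB⟩ hs).tsum_add (summable_bdd ⟨D, hD⟩ hs)]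
  simp only [add_mul]

lemma HasDens.smul {g : Nat.Primes → ℝ} {c : ℝ} (r : ℝ) (hg : HasDens g c) :
    HasDens (fun p => r * g p) (r * c) := by
  obtain ⟨⟨B, hB⟩, h1⟩ := hg
  refine ⟨⟨|r| * B, fun p => ?_⟩, ?_⟩
  · rw [abs_mul]; exact mul_le_mul_of_nonneg_left (hB p) (abs_nonneg _)
  refine (h1.const_mul r).congr fun s => ?_
  rw [← mul_div_assoc, ← tsum_mul_left]
  simp only [mul_assoc]

lemma HasDens.zero : HasDens (fun _ => 0) 0 := by
  refine ⟨⟨0, by simp⟩, ?_⟩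
  simp

lemma HasDens.sum {ι : Type*} (S : Finset ι) {g : ι → Nat.Primes → ℝ} {c : ι → ℝ}
    (h : ∀ i ∈ S, HasDens (g i) (c i)) :
    HasDens (fun p => ∑ i ∈ S, g i p) (∑ i ∈ S, c i) := by
  classical
  induction S using Finset.induction_on with
  | empty => simpa using HasDens.zero
  | insert a S ha ih =>
    simp only [Finset.sum_insert ha]
    exact (h a (by simp)).add (ih fun i hi => h i (by simp [hi]))

lemma HasDens.of_finite {g : Nat.Primes → ℝ} (hg : {p | g p ≠ 0}.Finite) : HasDens g 0 := by
  classical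
  have hs : ∀ p, p ∉ hg.toFinset → g p = 0 := by intro p hp; simpa using hp
  have hnn : 0 ≤ ∑ p ∈ hg.toFinset, |g p| := Finset.sum_nonneg fun _ _ => abs_nonneg _
  refine ⟨⟨∑ p ∈ hg.toFinset, |g p|, fun p => ?_⟩, ?_⟩
  · by_cases hp : p ∈ hg.toFinset
    · exact Finset.single_le_sum (f := fun p => |g p|) (fun _ _ => abs_nonneg _) hp
    · rw [hs p hp, abs_zero]; exact hnn
  · refine squeeze_zero_norm' ?_ (tendsto_L.const_div_atTop (∑ p ∈ hg.toFinset, |g p|))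
    filter_upwards [self_mem_nhdsWithin, tendsto_L.eventually_gt_atTop 0] with s hs1 hL
    have hs1 : 1 < s := hs1
    rw [tsum_eq_sum (s := hg.toFinset) (fun p hp => by rw [hs p hp, zero_mul]), norm_div,
      Real.norm_eq_abs, Real.norm_eq_abs, abs_of_pos hL]
    refine div_le_div_of_nonneg_right ?_ hL.le
    refine (Finset.abs_sum_le_sum_abs _ _).trans (Finset.sum_le_sum fun p _ => ?_)
    rw [abs_mul]
    refine mul_le_of_le_one_right (abs_nonneg _) ?_
    rw [abs_of_nonneg (by positivity)]
    exact Real.rpow_le_one_of_one_le_of_nonpos (by exact_mod_cast p.2.one_lt.le) (by linarith)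

lemma HasDens.congr {g h : Nat.Primes → ℝ} {c : ℝ} (hg : HasDens g c)
    (hf : {p | h p ≠ g p}.Finite) : HasDens h c := by
  have h1 : HasDens (fun p => h p - g p) 0 := HasDens.of_finite (by simpa [sub_eq_zero] using hf)
  simpa using hg.add h1

lemma HasDens.mono {g h : Nat.Primes → ℝ} {c d : ℝ} (hg : HasDens g c) (hh : HasDens h d)
    (hf : {p | ¬ g p ≤ h p}.Finite) : c ≤ d := by
  have h1 : HasDens (fun p => max (g p) (h p)) d := by
    refine hh.congr (hf.subset ?_)
    intro p hp hle
    exact hp (max_eq_right hle)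
  refine le_of_tendsto_of_tendsto hg.2 h1.2 ?_
  filter_upwards [self_mem_nhdsWithin, tendsto_L.eventually_gt_atTop 0] with s hs1 hL
  refine div_le_div_of_nonneg_right ?_ hL.le
  refine (summable_bdd hg.1 hs1).tsum_le_tsum (fun p => ?_) (summable_bdd h1.1 hs1)
  exact mul_le_mul_of_nonneg_right (le_max_left _ _) (by positivity)

end P2


section P3
open Filter Topology NumberField
variable (F : Type) [Field F] [NumberField F]

lemma dedekind_real {s : ℝ} (hs : s ≠ 0) : dedekindZeta F s =
    ((∑' n : ℕ, (idealCount F n : ℝ) * (n : ℝ) ^ (-s) : ℝ) : ℂ) := by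
  rw [dedekindZeta, LSeries, Complex.ofReal_tsum]
  refine tsum_congr fun n => ?_
  rcases eq_or_ne n 0 with rfl | hn
  · rw [LSeries.term_zero]
    simp [Real.zero_rpow (neg_ne_zero.2 hs)]
  · rw [LSeries.term_of_ne_zero hn, Complex.ofReal_mul, Complex.ofReal_cpow (by positivity), div_eq_mul_inv,
      ← Complex.cpow_neg]
    simp [idealCount]

lemma euler_tail (d : ℕ) : ∃ K : ℝ, 0 ≤ K ∧ ∀ (p : ℕ) (_ : 2 ≤ p) (s : ℝ) (_ : 1 ≤ s) (a : ℕ → ℝ)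
    (_ : ∀ e, 0 ≤ a e) (_ : ∀ e, a e ≤ ((e : ℝ) + 1) ^ d) (_ : a 0 = 1),
    Summable (fun e : ℕ => a e * ((p ^ e : ℕ) : ℝ) ^ (-s)) ∧
    1 + a 1 * (p : ℝ) ^ (-s) ≤ ∑' e : ℕ, a e * ((p ^ e : ℕ) : ℝ) ^ (-s) ∧
    ∑' e : ℕ, a e * ((p ^ e : ℕ) : ℝ) ^ (-s) ≤ 1 + a 1 * (p : ℝ) ^ (-s) + K * (p : ℝ) ^ (-2 : ℝ) := by
  have hsum0 : Summable (fun n : ℕ => (n : ℝ) ^ d * (1/2 : ℝ) ^ n) :=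
    summable_pow_mul_geometric_of_norm_lt_one d (by norm_num)
  have hsum : Summable (fun e : ℕ => ((e : ℝ) + 3) ^ d * (1/2 : ℝ) ^ e) := by
    have := ((summable_nat_add_iff 3).2 hsum0).mul_left (8 : ℝ)
    refine this.congr fun e => ?_
    push_cast
    rw [pow_add]
    ring
  refine ⟨∑' e : ℕ, ((e : ℝ) + 3) ^ d * (1/2 : ℝ) ^ e, tsum_nonneg fun e => by positivity, ?_⟩
  intro p hp s hs a ha0 ha1 ha
  have hp0 : (0 : ℝ) < p := by positivity
  have hp2 : (2 : ℝ) ≤ p := by exact_mod_cast hp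
  have hle : ∀ e : ℕ, a (e + 2) * ((p ^ (e + 2) : ℕ) : ℝ) ^ (-s) ≤
      (((e : ℝ) + 3) ^ d * (1/2 : ℝ) ^ e) * (p : ℝ) ^ (-2 : ℝ) := by
    intro e
    have h1 : ((p ^ (e + 2) : ℕ) : ℝ) ^ (-s) ≤ (1/2 : ℝ) ^ e * (p : ℝ) ^ (-2 : ℝ) := by
      have h2 : ((p ^ (e + 2) : ℕ) : ℝ) ^ (-s) ≤ ((p ^ (e + 2) : ℕ) : ℝ) ^ (-1 : ℝ) :=
        Real.rpow_le_rpow_of_exponent_le (by exact_mod_cast Nat.one_le_pow _ _ (by omega)) (by linarith)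
      refine h2.trans ?_
      rw [Real.rpow_neg_one, Real.rpow_neg hp0.le]
      push_cast
      rw [pow_add, mul_inv, ← inv_pow, Real.rpow_two]
      refine mul_le_mul_of_nonneg_right ?_ (by positivity)
      refine pow_le_pow_left₀ (by positivity) ?_ _
      rw [one_div]
      exact inv_anti₀ (by norm_num) hp2
    have h3 : a (e + 2) ≤ ((e : ℝ) + 3) ^ d := by
      have := ha1 (e + 2)
      push_cast at this
      convert this using 2
      ring
    calc _ ≤ ((e : ℝ) + 3) ^ d * ((1/2 : ℝ) ^ e * (p : ℝ) ^ (-2 : ℝ)) :=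
          mul_le_mul h3 h1 (by positivity) (by positivity)
      _ = _ := by ring
  have hnn : ∀ e : ℕ, 0 ≤ a (e + 2) * ((p ^ (e + 2) : ℕ) : ℝ) ^ (-s) := fun e =>
    mul_nonneg (ha0 _) (by positivity)
  have hs2 : Summable fun e : ℕ => a (e + 2) * ((p ^ (e + 2) : ℕ) : ℝ) ^ (-s) :=
    Summable.of_nonneg_of_le hnn hle (hsum.mul_right _)
  have hs3 : Summable (fun e : ℕ => a e * ((p ^ e : ℕ) : ℝ) ^ (-s)) :=
    (summable_nat_add_iff 2).1 hs2
  have hsplit := hs3.sum_add_tsum_nat_add 2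
  simp only [Finset.sum_range_succ, Finset.sum_range_zero, pow_zero, pow_one, ha, Nat.cast_one,
    Real.one_rpow, zero_add, mul_one] at hsplit
  refine ⟨hs3, ?_, ?_⟩
  · rw [← hsplit]
    exact le_add_of_nonneg_right (tsum_nonneg hnn)
  · rw [← hsplit, ← tsum_mul_right]
    exact add_le_add le_rfl (hs2.tsum_le_tsum hle (hsum.mul_right _))

lemma log_est {x y r C D t : ℝ} (hy : 0 ≤ y) (hr : 0 ≤ r) (ht : 0 ≤ t) (ht1 : t ≤ 1) (hC : 0 ≤ C)
    (hyC : y ≤ D * t)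
    (hrC : r ≤ C * t ^ 2) (hx : x = 1 + y + r) :
    |Real.log x - y| ≤ (C + (D + C) ^ 2) * t ^ 2 := by
  have hxpos : 0 < x := by linarith
  have h1 := Real.log_le_sub_one_of_pos hxpos
  have h2 := Real.one_sub_inv_le_log_of_pos hxpos
  have h3 : (y + r) - (y + r) ^ 2 ≤ 1 - x⁻¹ := by
    have : 1 - x⁻¹ = (y + r) - (y + r) ^ 2 / x := by
      field_simp
      rw [hx]; ring
    rw [this]
    have : (y + r) ^ 2 / x ≤ (y + r) ^ 2 := div_le_self (sq_nonneg _) (by linarith)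
    linarith
  have h4 : y + r ≤ (D + C) * t := by nlinarith [mul_nonneg hC (mul_nonneg ht (sub_nonneg.2 ht1))]
  have h5 : (y + r) ^ 2 ≤ ((D + C) * t) ^ 2 := pow_le_pow_left₀ (by linarith) h4 2
  rw [abs_le]
  constructor
  · nlinarith [sq_nonneg t]
  · nlinarith [sq_nonneg t, mul_nonneg (sq_nonneg (D+C)) (sq_nonneg t)]

lemma hasDens_idealCount : HasDens (fun p => (idealCount F p : ℝ)) 1 := by
  set d := Module.finrank ℚ F
  have hbd : ∀ p : Nat.Primes, |(idealCount F p : ℝ)| ≤ 2 ^ d := by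
    intro p
    have := idealCount_prime_pow_le F p.2 1
    rw [pow_one] at this
    rw [abs_of_nonneg (by positivity)]
    exact_mod_cast this
  refine ⟨⟨_, hbd⟩, ?_⟩
  obtain ⟨K, hK0, hK⟩ := euler_tail d
  set Z : ℝ → ℝ := fun s => ∑' n : ℕ, (idealCount F n : ℝ) * (n : ℝ) ^ (-s) with hZ
  have hres : Tendsto (fun s : ℝ => (s - 1) * Z s) (𝓝[>] 1) (𝓝 (dedekindZeta_residue F)) := by
    have := tendsto_sub_one_mul_dedekindZeta_nhdsGT F
    rw [← Filter.tendsto_ofReal_iff]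
    refine this.congr' ?_
    filter_upwards [self_mem_nhdsWithin] with s hs
    have hs : 1 < s := hs
    rw [dedekind_real F (by linarith : s ≠ 0)]
    rw [Complex.ofReal_mul, Complex.ofReal_sub, Complex.ofReal_one]
  have hrpos := dedekindZeta_residue_pos F
  set C := K + (2 ^ d + K) ^ 2 with hC
  have hsum2 : Summable (fun p : Nat.Primes => ((p : ℝ)⁻¹) ^ 2) := by
    have : Summable (fun p : Nat.Primes => (p : ℝ) ^ (-2 : ℝ)) := Nat.Primes.summable_rpow.2 (by norm_num)
    refine this.congr fun p => ?_
    rw [Real.rpow_neg (by positivity), Real.rpow_two, inv_pow]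
  set A := C * ∑' p : Nat.Primes, ((p : ℝ)⁻¹) ^ 2 with hA
  have hmain : ∀ᶠ s : ℝ in 𝓝[>] 1,
      |Real.log (Z s) - ∑' p : Nat.Primes, (idealCount F p : ℝ) * (p : ℝ) ^ (-s)| ≤ A := by
    filter_upwards [self_mem_nhdsWithin, hres.eventually (lt_mem_nhds hrpos)] with s hs hpos
    have hs : 1 < s := hs
    have hZpos : 0 < Z s := by
      by_contra h
      push Not at h
      nlinarith
    have hsm : Summable (fun n : ℕ => (idealCount F n : ℝ) * (n : ℝ) ^ (-s)) := by
      by_contra h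
      have : Z s = 0 := tsum_eq_zero_of_not_summable h
      linarith
    have hprod := EulerProduct.eulerProduct_hasProd
      (f := fun n : ℕ => (idealCount F n : ℝ) * (n : ℝ) ^ (-s)) (by simp [idealCount_one])
      (by
        intro m n hmn
        simp only [idealCount_mul F hmn]
        push_cast
        rw [Real.mul_rpow (by positivity) (by positivity)]
        ring) hsm.norm
      (by simp [Real.zero_rpow (show -s ≠ 0 by linarith)])
    set E : Nat.Primes → ℝ := fun p => ∑' e : ℕ, (idealCount F ((p:ℕ) ^ e) : ℝ) * (((p:ℕ) ^ e : ℕ) : ℝ) ^ (-s) with hE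
    have hprod : HasProd E (Z s) := hprod
    have hest : ∀ p : Nat.Primes, 1 ≤ E p ∧ |Real.log (E p) - (idealCount F p : ℝ) * (p : ℝ) ^ (-s)| ≤ C * ((p : ℝ)⁻¹) ^ 2 := by
      intro p
      obtain ⟨-, h1, h2⟩ := hK p p.2.two_le s hs.le (fun e => (idealCount F ((p:ℕ) ^ e) : ℝ)) (fun e => by positivity)
        (fun e => by exact_mod_cast idealCount_prime_pow_le F p.2 e) (by simp [idealCount_one])
      simp only [pow_one] at h1 h2
      change _ ≤ E p at h1
      change E p ≤ _ at h2
      have hy : 0 ≤ (idealCount F p : ℝ) * (p : ℝ) ^ (-s) := by positivity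
      refine ⟨by linarith, ?_⟩
      have hp1 : (1 : ℝ) ≤ p := by exact_mod_cast p.2.one_lt.le
      refine log_est (r := E p - (1 + (idealCount F p : ℝ) * (p : ℝ) ^ (-s))) hy (by linarith) (by positivity)
        (inv_le_one_of_one_le₀ hp1) hK0 ?_ ?_ (by ring)
      · have hb := hbd p
        rw [abs_of_nonneg (by positivity)] at hb
        refine mul_le_mul hb ?_ (by positivity) (by positivity)
        rw [← Real.rpow_neg_one]
        exact Real.rpow_le_rpow_of_exponent_le hp1 (by linarith)
      · have h3 : (p : ℝ) ^ (-2 : ℝ) = ((p : ℝ)⁻¹) ^ 2 := by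
          rw [Real.rpow_neg (by positivity), Real.rpow_two, inv_pow]
        rw [h3] at h2
        linarith
    have hs1 : Summable (fun p : Nat.Primes => (idealCount F p : ℝ) * (p : ℝ) ^ (-s)) := summable_bdd ⟨_, hbd⟩ hs
    have hs2 : Summable (fun p : Nat.Primes => Real.log (E p) - (idealCount F p : ℝ) * (p : ℝ) ^ (-s)) :=
      Summable.of_norm_bounded (hsum2.mul_left C) fun p => (hest p).2
    have hs3 : Summable (fun p : Nat.Primes => Real.log (E p)) := by
      simpa using hs2.add hs1
    have hlog : Real.log (Z s) = ∑' p : Nat.Primes, Real.log (E p) := by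
      have h1 := hs3.hasSum.rexp
      have h2 : (Real.exp ∘ fun p : Nat.Primes => Real.log (E p)) = E := by
        funext p
        exact Real.exp_log (by linarith [(hest p).1])
      rw [h2] at h1
      rw [hprod.unique h1, Real.log_exp]
    rw [hlog, ← hs3.tsum_sub hs1, hA, ← tsum_mul_left]
    rw [← Real.norm_eq_abs]
    exact tsum_of_norm_bounded (hsum2.mul_left C).hasSum fun p => (hest p).2
  -- conclude
  have hL := tendsto_L
  have hlogres : Tendsto (fun s : ℝ => Real.log ((s - 1) * Z s) / Real.log (1 / (s - 1))) (𝓝[>] 1) (𝓝 0) :=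
    ((Real.continuousAt_log hrpos.ne').tendsto.comp hres).div_atTop hL
  have herr : Tendsto (fun s : ℝ => (Real.log (Z s) - ∑' p : Nat.Primes, (idealCount F p : ℝ) * (p : ℝ) ^ (-s)) / Real.log (1 / (s - 1))) (𝓝[>] 1) (𝓝 0) := by
    refine squeeze_zero_norm' ?_ (hL.const_div_atTop A)
    filter_upwards [hmain, hL.eventually_gt_atTop 0] with s h1 h2
    rw [norm_div, Real.norm_eq_abs, Real.norm_eq_abs, abs_of_pos h2]
    exact div_le_div_of_nonneg_right h1 h2.le
  have := (hlogres.sub herr).const_add 1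
  simp only [sub_zero, add_zero] at this
  refine this.congr' ?_
  filter_upwards [self_mem_nhdsWithin, hres.eventually (lt_mem_nhds hrpos), hL.eventually_gt_atTop 0] with s hs hpos hLp
  have hs : 1 < s := hs
  have hZ0 : Z s ≠ 0 := by rintro h; rw [h] at hpos; simp at hpos
  have e1 : Real.log ((s - 1) * Z s) = Real.log (Z s) - Real.log (1 / (s - 1)) := by
    rw [Real.log_mul (by linarith) hZ0, one_div, Real.log_inv]; ring
  rw [e1]
  field_simp
  ring

end P3


/-- number of roots of f mod p -/
noncomputable def rootCount (f : Polynomial ℤ) (p : ℕ) : ℕ :=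
  Nat.card {x : ZMod p // (f.map (Int.castRingHom (ZMod p))).eval x = 0}

section KD
open Polynomial NumberField

theorem idealCount_eq_rootCount (F : Type) [Field F] [NumberField F] (θ : 𝓞 F) (p : ℕ)
    [Fact p.Prime] (hp : ¬ p ∣ RingOfIntegers.exponent θ) :
    idealCount F p = rootCount (minpoly ℤ θ) p := by
  classical
  have hP : p.Prime := Fact.out
  set g := (minpoly ℤ θ).map (Int.castRingHom (ZMod p)) with hg
  have hmon : (minpoly ℤ θ).Monic := minpoly.monic θ.isIntegral
  have hg0 : g ≠ 0 := (hmon.map _).ne_zero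
  have hmem : ∀ x : {x : ZMod p // g.eval x = 0},
      (X - C x.1) ∈ RingOfIntegers.monicFactorsMod θ p := by
    intro x
    rw [Multiset.mem_toFinset, Polynomial.mem_normalizedFactors_iff hg0]
    exact ⟨irreducible_X_sub_C _, monic_X_sub_C _, dvd_iff_isRoot.2 x.2⟩
  let e := NumberField.Ideal.primesOverSpanEquivMonicFactorsMod hp
  have hnorm : ∀ Q (hQ : Q ∈ RingOfIntegers.monicFactorsMod θ p),
      Ideal.absNorm (e.symm ⟨Q, hQ⟩ : Ideal (𝓞 F)) = p ^ Q.natDegree := by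
    intro Q hQ
    have h1 := NumberField.Ideal.inertiaDeg_primesOverSpanEquivMonicFactorsMod_symm_apply' hp hQ
    have : (e.symm ⟨Q, hQ⟩ : Ideal (𝓞 F)).IsPrime := (e.symm ⟨Q, hQ⟩).2.1
    have : (e.symm ⟨Q, hQ⟩ : Ideal (𝓞 F)).LiesOver (Ideal.span {(p : ℤ)}) :=
      (e.symm ⟨Q, hQ⟩).2.2
    rw [← Ideal.pow_inertiaDeg p, h1]
  symm
  unfold idealCount rootCount
  refine Nat.card_congr (Equiv.ofBijective (fun x => ⟨e.symm ⟨X - C x.1, hmem x⟩, ?_⟩) ⟨?_, ?_⟩)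
  · rw [hnorm]; simp
  · intro x y hxy
    have h1 := congrArg Subtype.val hxy
    have h2 := e.symm.injective (Subtype.ext h1)
    have h3 := congrArg Subtype.val h2
    simp only [sub_right_inj] at h3
    exact Subtype.ext (C_injective h3)
  · rintro ⟨I, hI⟩
    have hIp : I.IsPrime := Ideal.isPrime_of_irreducible_absNorm (by rw [hI]; exact hP)
    have hlo : I.LiesOver (Ideal.span {(p : ℤ)}) := by
      rw [Ideal.liesOver_iff, Ideal.under_def, ← Ideal.span_singleton_absNorm (by rw [hI]; exact hP), hI]
    obtain ⟨⟨Q, hQ⟩, hQe⟩ := e.symm.surjective ⟨I, hIp, hlo⟩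
    have hd := hnorm Q hQ
    rw [hQe] at hd
    simp only [hI] at hd
    have hd1 : Q.natDegree = 1 := by
      have : p ^ 1 = p ^ Q.natDegree := by simpa using hd
      exact (Nat.pow_right_injective hP.two_le this).symm
    have hQ' := hQ
    rw [Multiset.mem_toFinset, Polynomial.mem_normalizedFactors_iff hg0] at hQ'
    obtain ⟨-, hQm, hQd⟩ := hQ'
    have hQX : Q = X - C (- Q.coeff 0) := by
      rw [hQm.eq_X_add_C hd1]; simp
    refine ⟨⟨- Q.coeff 0, ?_⟩, ?_⟩
    · exact dvd_iff_isRoot.1 (hQX ▸ hQd)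
    · apply Subtype.ext
      have : (⟨X - C (-Q.coeff 0), hmem ⟨- Q.coeff 0, dvd_iff_isRoot.1 (hQX ▸ hQd)⟩⟩ :
          RingOfIntegers.monicFactorsMod θ p) = ⟨Q, hQ⟩ := Subtype.ext hQX.symm
      show ((e.symm ⟨X - C (-Q.coeff 0), _⟩ : _) : Ideal (𝓞 F)) = I
      rw [this, hQe]

theorem exponent_ne_zero_of (F : Type) [Field F] [NumberField F] (θ : 𝓞 F)
    (B : PowerBasis ℚ F) (hB : B.gen = (θ : F)) : RingOfIntegers.exponent θ ≠ 0 := by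
  classical
  have hint : IsIntegral ℤ B.gen := by rw [hB]; exact θ.2
  have hDint : IsIntegral ℤ (Algebra.discr ℚ B.basis) := by
    apply Algebra.discr_isIntegral ℚ
    intro i
    rw [B.basis_eq_pow]
    exact hint.pow _
  obtain ⟨D, hD⟩ := IsIntegrallyClosed.isIntegral_iff.1 hDint
  have hD0 : D ≠ 0 := by
    rintro rfl
    exact Algebra.discr_not_zero_of_basis ℚ B.basis (by rw [← hD]; simp)
  have hcond : (D : 𝓞 F) ∈ conductor ℤ θ := by
    rw [mem_conductor_iff]
    intro b
    have h1 := Algebra.discr_mul_isIntegral_mem_adjoin ℚ (R := ℤ) hint (z := (b : F)) b.2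
    rw [← hD, hB] at h1
    have h2 : Algebra.adjoin ℤ {(θ : F)} =
        (Algebra.adjoin ℤ {θ}).map (Algebra.ofId (𝓞 F) F |>.restrictScalars ℤ) := by
      rw [AlgHom.map_adjoin_singleton]; rfl
    rw [h2] at h1
    obtain ⟨y, hy, hy2⟩ := h1
    have : (D : 𝓞 F) * b = y := by
      apply RingOfIntegers.coe_injective
      have h3 : (algebraMap (𝓞 F) F) y = (algebraMap ℤ ℚ D) • (b : F) := hy2
      show algebraMap (𝓞 F) F (D * b) = _
      rw [h3]
      simp [Algebra.smul_def]
    rw [this]; exact hy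
  rw [RingOfIntegers.exponent_eq_sInf]
  have hne : {d : ℕ | 0 < d ∧ (d : 𝓞 F) ∈ conductor ℤ θ}.Nonempty := by
    refine ⟨D.natAbs, Int.natAbs_pos.2 hD0, ?_⟩
    rcases Int.natAbs_eq D with h | h
    · have h2 : (D : 𝓞 F) = (D.natAbs : 𝓞 F) := by
        conv_lhs => rw [h]
        rw [Int.cast_natCast]
      exact h2 ▸ hcond
    · have h2 : (D : 𝓞 F) = -(D.natAbs : 𝓞 F) := by
        conv_lhs => rw [h]
        rw [Int.cast_neg, Int.cast_natCast]
      rw [h2] at hcond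
      exact (Submodule.neg_mem_iff _).1 hcond
  exact (Nat.sInf_mem hne).1.ne'

theorem hasDens_rootCount (f : ℤ[X]) (hf : f.Monic)
    (hirr : Irreducible (f.map (Int.castRingHom ℚ))) :
    HasDens (fun p => (rootCount f p : ℝ)) 1 := by
  classical
  set g := f.map (Int.castRingHom ℚ) with hg
  have : Fact (Irreducible g) := ⟨hirr⟩
  have hgm : g.Monic := hf.map _
  let B := AdjoinRoot.powerBasis hirr.ne_zero
  have : CharZero (AdjoinRoot g) := charZero_of_injective_algebraMap (algebraMap ℚ _).injective
  have : FiniteDimensional ℚ (AdjoinRoot g) := B.finite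
  have : NumberField (AdjoinRoot g) := ⟨⟩
  have hroot : IsIntegral ℤ (AdjoinRoot.root g) := by
    refine ⟨f, hf, ?_⟩
    have := AdjoinRoot.eval₂_root g
    rw [hg, eval₂_map] at this
    rw [← this]
    exact congrArg (fun φ => eval₂ φ _ f) (RingHom.ext_int _ _)
  let θ : 𝓞 (AdjoinRoot g) := ⟨AdjoinRoot.root g, hroot⟩
  have hmin : minpoly ℤ θ = f := by
    apply map_injective (Int.castRingHom ℚ) Int.cast_injective
    rw [← RingOfIntegers.minpoly_coe]
    have h1 := minpoly.isIntegrallyClosed_eq_field_fractions' ℚ hroot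
    have h2 := AdjoinRoot.minpoly_powerBasis_gen_of_monic hgm
    rw [AdjoinRoot.powerBasis_gen] at h2
    exact h1.symm.trans h2
  have hexp := exponent_ne_zero_of (AdjoinRoot g) θ B (AdjoinRoot.powerBasis_gen _)
  refine (hasDens_idealCount (AdjoinRoot g)).congr ?_
  have hfin : {p : Nat.Primes | (p : ℕ) ∣ RingOfIntegers.exponent θ}.Finite := by
    apply Set.Finite.of_finite_image (f := fun p : Nat.Primes => (p : ℕ)) _
      Subtype.val_injective.injOn
    apply (Set.finite_Iic (RingOfIntegers.exponent θ)).subset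
    rintro _ ⟨p, hp, rfl⟩
    exact Nat.le_of_dvd (Nat.pos_of_ne_zero hexp) hp
  refine hfin.subset ?_
  intro p hp
  by_contra hcon
  have : Fact (p : ℕ).Prime := ⟨p.2⟩
  apply hp
  have := idealCount_eq_rootCount _ θ p hcon
  rw [hmin] at this
  exact congrArg (fun n : ℕ => (n : ℝ)) this.symm
end KD


section NT
open Polynomial NumberField

/-- p splits in the q-th cyclotomic field -/
def HasZeta (q p : ℕ) : Prop := ∃ ζ : ZMod p, IsPrimitiveRoot ζ q

/-- a is a q-th power mod p -/
def IsQPow (q : ℕ) (a : ℤ) (p : ℕ) : Prop := ∃ x : ZMod p, x ^ q = (a : ZMod p)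

open Classical in
/-- indicator of a proposition -/
noncomputable def ind (P : Prop) : ℝ := if P then 1 else 0

theorem finite_primes_dvd (n : ℕ) (hn : n ≠ 0) : {p : Nat.Primes | (p : ℕ) ∣ n}.Finite := by
  apply Set.Finite.of_finite_image (f := fun p : Nat.Primes => (p : ℕ)) _
    Subtype.val_injective.injOn
  apply (Set.finite_Iic n).subset
  rintro _ ⟨p, hp, rfl⟩
  exact Nat.le_of_dvd (Nat.pos_of_ne_zero hn) hp

theorem hasDens_one : HasDens (fun _ => 1) 1 := by
  have h := hasDens_rootCount (X : ℤ[X]) monic_X (by simpa using irreducible_X)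
  convert h using 2 with p
  have : Nat.card {x : ZMod (p : ℕ) // x = 0} = 1 := by simp
  simp only [rootCount, Polynomial.map_X, eval_X]
  rw [this]; simp

theorem natCast_ne_zero_of (p n : ℕ) (h : ¬ p ∣ n) : (n : ZMod p) ≠ 0 := by
  rwa [Ne, ZMod.natCast_eq_zero_iff]

theorem rootCount_cyclotomic (q p : ℕ) (hq : q.Prime) [Fact p.Prime] (h : ¬ p ∣ q) :
    (rootCount (cyclotomic q ℤ) p : ℝ) = (q - 1 : ℝ) * ind (HasZeta q p) := by
  classical
  have : NeZero ((q : ℕ) : ZMod p) := ⟨natCast_ne_zero_of p q h⟩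
  have h1 : rootCount (cyclotomic q ℤ) p = (primitiveRoots q (ZMod p)).card := by
    unfold rootCount
    rw [← Nat.card_eq_fintype_card.trans (Fintype.card_coe _)]
    apply Nat.card_congr
    apply Equiv.subtypeEquivRight
    intro x
    rw [map_cyclotomic, mem_primitiveRoots hq.pos, ← isRoot_cyclotomic_iff, IsRoot]
  rw [h1, ind]
  split_ifs with hz
  · obtain ⟨ζ, hζ⟩ := hz
    rw [hζ.card_primitiveRoots, Nat.totient_prime hq, Nat.cast_sub hq.one_le]; simp
  · have : primitiveRoots q (ZMod p) = ∅ := by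
      ext x
      simp only [mem_primitiveRoots hq.pos, Finset.notMem_empty, iff_false]
      exact fun hx => hz ⟨x, hx⟩
    rw [this]; simp

theorem hasDens_zeta (q : ℕ) (hq : q.Prime) :
    HasDens (fun p => ind (HasZeta q p)) (1 / (q - 1 : ℝ)) := by
  have hq1 : (q - 1 : ℝ) ≠ 0 := by
    have : (1 : ℝ) < q := by exact_mod_cast hq.one_lt
    linarith
  have h := hasDens_rootCount (cyclotomic q ℤ) (cyclotomic.monic q ℤ)
    (by rw [map_cyclotomic]; exact cyclotomic.irreducible_rat hq.pos)
  have h2 := h.smul (1 / (q - 1 : ℝ))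
  rw [mul_one] at h2
  refine h2.congr ((finite_primes_dvd q hq.ne_zero).subset ?_)
  intro p hp
  by_contra hcon
  have : Fact (p : ℕ).Prime := ⟨p.2⟩
  apply hp
  have := rootCount_cyclotomic q p hq hcon
  show ind (HasZeta q p) = 1 / (q - 1 : ℝ) * (rootCount (cyclotomic q ℤ) p : ℝ)
  rw [this]; field_simp

theorem rootCount_pow (q p : ℕ) (hq : q.Prime) [Fact p.Prime] (a : ℤ) (h : (a : ZMod p) ≠ 0) :
    (rootCount (X ^ q - C a) p : ℝ) =
      1 - ind (HasZeta q p) + q * ind (HasZeta q p ∧ IsQPow q a p) := by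
  classical
  have h1 : rootCount (X ^ q - C a) p = Nat.card {x : ZMod p // x ^ q = (a : ZMod p)} := by
    unfold rootCount
    apply Nat.card_congr
    apply Equiv.subtypeEquivRight
    intro x
    simp [sub_eq_zero]
  rw [h1]
  by_cases hz : HasZeta q p
  · obtain ⟨ζ, hζ⟩ := id hz
    have h2 : Nat.card {x : ZMod p // x ^ q = (a : ZMod p)} =
        (nthRoots q (a : ZMod p)).card := by
      rw [← Multiset.toFinset_card_of_nodup (hζ.nthRoots_nodup h)]
      rw [← Nat.card_eq_fintype_card.trans (Fintype.card_coe _)]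
      apply Nat.card_congr
      apply Equiv.subtypeEquivRight
      intro x
      simp [mem_nthRoots hq.pos]
    rw [h2, hζ.card_nthRoots]
    by_cases ha : IsQPow q a p
    · have ha' : ∃ α : ZMod p, α ^ q = (a : ZMod p) := ha
      simp [ind, hz, ha, ha']
    · have ha' : ¬ ∃ α : ZMod p, α ^ q = (a : ZMod p) := ha
      simp only [ind, hz, ha, ha']; simp
  · have hinj : Function.Injective (fun x : ZMod p => x ^ q) := by
      intro x y hxy
      simp only at hxy
      by_cases hy : y = 0
      · subst hy
        rw [zero_pow hq.ne_zero] at hxy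
        exact eq_zero_of_pow_eq_zero hxy
      · have h3 : (x / y) ^ q = 1 := by
          rw [div_pow, hxy, div_self (pow_ne_zero _ hy)]
        by_contra hne
        have h4 : x / y ≠ 1 := fun h => hne ((div_eq_one_iff_eq hy).1 h)
        apply hz
        refine ⟨x / y, ?_⟩
        rw [IsPrimitiveRoot.iff_orderOf]
        exact (orderOf_eq_prime_iff (hp := ⟨hq⟩)).2 ⟨h3, h4⟩
    have hbij := Finite.injective_iff_bijective.1 hinj
    obtain ⟨x, hx, hux⟩ := hbij.existsUnique (a : ZMod p)
    have h2 : Nat.card {x : ZMod p // x ^ q = (a : ZMod p)} = 1 := by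
      rw [Nat.card_eq_one_iff_unique]
      exact ⟨⟨fun u v => Subtype.ext ((hux _ u.2).trans (hux _ v.2).symm)⟩, ⟨⟨x, hx⟩⟩⟩
    rw [h2]
    simp [ind, hz]

theorem hasDens_qpow (q : ℕ) (hq : q.Prime) (a : ℤ) (ha : ¬ ∃ r : ℤ, r ^ q = a) :
    HasDens (fun p => ind (HasZeta q p ∧ IsQPow q a p)) (1 / (q * (q - 1) : ℝ)) := by
  have hq1 : (q - 1 : ℝ) ≠ 0 := by
    have : (1 : ℝ) < q := by exact_mod_cast hq.one_lt
    linarith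
  have hq0 : (q : ℝ) ≠ 0 := by exact_mod_cast hq.ne_zero
  have ha0 : a ≠ 0 := by
    rintro rfl
    exact ha ⟨0, zero_pow hq.ne_zero⟩
  have hirr : Irreducible ((X ^ q - C a : ℤ[X]).map (Int.castRingHom ℚ)) := by
    have h1 : ((X ^ q - C a : ℤ[X]).map (Int.castRingHom ℚ)) = X ^ q - C (a : ℚ) := by simp
    rw [h1]
    apply X_pow_sub_C_irreducible_of_prime hq
    intro b hb
    have hint : IsIntegral ℤ b := by
      refine IsIntegral.of_pow hq.pos ?_
      rw [hb]
      exact isIntegral_algebraMap (x := a)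
    obtain ⟨r, hr⟩ := IsIntegrallyClosed.isIntegral_iff.1 hint
    refine ha ⟨r, ?_⟩
    rw [← hr] at hb
    have hb' : ((r ^ q : ℤ) : ℚ) = (a : ℚ) := by rw [← hb]; simp
    exact Int.cast_injective hb'
  have h := hasDens_rootCount (X ^ q - C a) (monic_X_pow_sub_C a hq.ne_zero) hirr
  have h2 := ((h.add (hasDens_one.smul (-1))).add (hasDens_zeta q hq)).smul (1 / q : ℝ)
  have he : 1 / (q : ℝ) * (1 + -1 * 1 + 1 / (q - 1)) = 1 / (q * (q - 1) : ℝ) := by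
    field_simp; ring
  rw [he] at h2
  refine h2.congr ((finite_primes_dvd a.natAbs (Int.natAbs_ne_zero.2 ha0)).subset ?_)
  intro p hp
  by_contra hcon
  have : Fact (p : ℕ).Prime := ⟨p.2⟩
  apply hp
  have h3 : ((a : ℤ) : ZMod p) ≠ 0 := by
    rw [Ne, ZMod.intCast_zmod_eq_zero_iff_dvd]
    intro hd
    exact hcon (Int.natCast_dvd.1 hd)
  have := rootCount_pow q p hq a h3
  show ind (HasZeta q p ∧ IsQPow q a p) = 1 / q * ((rootCount (X ^ q - C a) p : ℝ) + -1 * 1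
    + ind (HasZeta q p))
  rw [this]; field_simp; ring

theorem lift_integral (F : Type) [Field F] (x : F) (h : IsIntegral ℤ x) :
    ∃ y : 𝓞 F, algebraMap (𝓞 F) F y = x := ⟨⟨x, h⟩, rfl⟩

theorem exists_split_field (q : ℕ) (hq : q.Prime) (S : Finset ℤ) :
    ∃ (F : Type) (_ : Field F) (_ : NumberField F), ∀ p : ℕ, p.Prime → ¬ p ∣ q →
      idealCount F p ≠ 0 → HasZeta q p ∧ ∀ s ∈ S, IsQPow q s p := by
  classical
  let f : ℚ[X] := cyclotomic q ℚ * ∏ s ∈ S, (X ^ q - C (s : ℚ))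
  have : CharZero f.SplittingField := charZero_of_injective_algebraMap (algebraMap ℚ _).injective
  have : NumberField f.SplittingField := ⟨⟩
  refine ⟨f.SplittingField, inferInstance, inferInstance, ?_⟩
  have hf0 : f ≠ 0 := by
    apply mul_ne_zero (cyclotomic_ne_zero q ℚ)
    rw [Finset.prod_ne_zero_iff]
    intro s _
    exact X_pow_sub_C_ne_zero hq.pos _
  have hsp := SplittingField.splits f
  have hex : ∀ g : ℚ[X], g ∣ f → g.degree ≠ 0 →
      ∃ z : f.SplittingField, eval z (g.map (algebraMap ℚ f.SplittingField)) = 0 := by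
    intro g hg hd
    have h1 : (g.map (algebraMap ℚ f.SplittingField)).Splits :=
      hsp.of_dvd (Polynomial.map_ne_zero hf0) (Polynomial.map_dvd _ hg)
    exact h1.exists_eval_eq_zero (by rwa [degree_map])
  obtain ⟨ζ, hζ⟩ := hex (cyclotomic q ℚ) (Dvd.intro _ rfl) (degree_cyclotomic_pos q ℚ hq.pos).ne'
  have hs : ∀ s ∈ S, ∃ z : f.SplittingField, z ^ q = (s : f.SplittingField) := by
    intro s hs
    obtain ⟨z, hz⟩ := hex (X ^ q - C (s : ℚ)) ((Finset.dvd_prod_of_mem _ hs).mul_left _)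
      (by rw [degree_X_pow_sub_C hq.pos]; exact_mod_cast hq.ne_zero)
    refine ⟨z, ?_⟩
    simpa [sub_eq_zero] using hz
  intro p hp hpq hI
  have : Fact p.Prime := ⟨hp⟩
  have hne : Nonempty {I : Ideal (𝓞 f.SplittingField) // Ideal.absNorm I = p} :=
    (Nat.card_ne_zero.1 hI).1
  obtain ⟨I, hI⟩ := hne
  have hcard : Nat.card (𝓞 f.SplittingField ⧸ I) = p := by
    rw [← hI, Ideal.absNorm_apply, Submodule.cardQuot_apply]
  have : Finite (𝓞 f.SplittingField ⧸ I) := Nat.finite_of_card_ne_zero (by rw [hcard]; exact hp.ne_zero)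
  have := Fintype.ofFinite (𝓞 f.SplittingField ⧸ I)
  let e := ZMod.ringEquivOfPrime (𝓞 f.SplittingField ⧸ I) hp
    (by rw [← Nat.card_eq_fintype_card, hcard])
  let φ : 𝓞 f.SplittingField →+* ZMod p :=
    (e.symm : _ →+* ZMod p).comp (Ideal.Quotient.mk I)
  constructor
  · have : NeZero ((q : ℕ) : ZMod p) := ⟨natCast_ne_zero_of p q hpq⟩
    have hint : IsIntegral ℤ ζ := by
      refine ⟨cyclotomic q ℤ, cyclotomic.monic q ℤ, ?_⟩
      rw [map_cyclotomic] at hζ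
      rw [eval₂_eq_eval_map, map_cyclotomic]; exact hζ
    obtain ⟨y, hy⟩ := lift_integral _ ζ hint
    have hz : eval y (cyclotomic q (𝓞 f.SplittingField)) = 0 := by
      apply RingOfIntegers.coe_injective
      rw [map_cyclotomic, ← hy] at hζ
      rw [map_zero, ← hζ, ← map_cyclotomic q (algebraMap (𝓞 f.SplittingField) f.SplittingField)]
      exact (eval_map_apply ..).symm
    refine ⟨φ y, isRoot_cyclotomic_iff.1 ?_⟩
    rw [IsRoot, ← map_cyclotomic q φ, eval_map_apply, hz, map_zero]
  · intro s hsS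
    obtain ⟨z, hz⟩ := hs s hsS
    have hint : IsIntegral ℤ z := by
      refine IsIntegral.of_pow hq.pos ?_
      rw [hz]
      exact isIntegral_algebraMap (x := s)
    obtain ⟨y, hy⟩ := lift_integral _ z hint
    refine ⟨φ y, ?_⟩
    rw [← map_pow, ← map_intCast φ]
    congr 1
    apply RingOfIntegers.coe_injective
    rw [map_pow, map_intCast, hy]
    exact hz
end NT


theorem exists_good_prime (q : ℕ) (hq : q.Prime) (S : Finset ℤ)
    (hS : ∀ s ∈ S, ¬ ∃ r : ℤ, r ^ q = s) (T : ℕ) (hc : S.card ≤ q * (T + 1))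
    (Δ : ℕ) (hΔ : 0 < Δ) :
    ∃ p : ℕ, p.Prime ∧ ¬ p ∣ Δ ∧ ∃ S' : Finset ℤ, S' ⊆ S ∧ S'.card ≤ T ∧
      ∀ s ∈ S, s ∉ S' → ¬ IsQPow q s p := by
  classical
  by_contra hcon
  have hall : ∀ p : ℕ, p.Prime → ¬ p ∣ Δ → T + 1 ≤ (S.filter (fun s => IsQPow q s p)).card := by
    intro p hp hd
    by_contra hlt
    refine hcon ⟨p, hp, hd, S.filter (fun s => IsQPow q s p), filter_subset _ _, by omega, ?_⟩
    intro s hs hs2 h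
    exact hs2 (mem_filter.2 ⟨hs, h⟩)
  have hge : T + 1 ≤ S.card := by
    obtain ⟨p, hp1, hp2⟩ := Nat.exists_infinite_primes (Δ + 1)
    have hd : ¬ p ∣ Δ := fun h => by
      have := Nat.le_of_dvd hΔ h
      omega
    exact (hall p hp2 hd).trans (card_le_card (filter_subset _ _))
  obtain ⟨F, _, _, hF⟩ := exists_split_field q hq S
  set d := Module.finrank ℚ F
  have hdG := HasDens.sum S (g := fun s p => ind (HasZeta q p ∧ IsQPow q s p))
    (c := fun _ => 1 / (q * (q - 1) : ℝ)) (fun s hs => hasDens_qpow q hq s (hS s hs))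
  have hdH := ((hasDens_zeta q hq).smul ((T : ℝ) + 1)).add
    ((hasDens_idealCount F).smul (((S.card : ℝ) - T - 1) / 2 ^ d))
  have hge' : (T : ℝ) + 1 ≤ S.card := by exact_mod_cast hge
  have hkey := hdH.mono hdG (by
    refine ((finite_primes_dvd q hq.ne_zero).union (finite_primes_dvd Δ hΔ.ne')).subset ?_
    intro p hp
    by_contra hno
    have hno1 : ¬ (p : ℕ) ∣ q := fun h => hno (Or.inl h)
    have hno2 : ¬ (p : ℕ) ∣ Δ := fun h => hno (Or.inr h)
    apply hp
    have hid : (idealCount F p : ℝ) ≤ 2 ^ d := by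
      have := idealCount_prime_pow_le F p.2 1
      rw [pow_one] at this
      exact_mod_cast this
    show ((T : ℝ) + 1) * ind (HasZeta q p) + ((S.card : ℝ) - T - 1) / 2 ^ d * (idealCount F p : ℝ)
      ≤ ∑ s ∈ S, ind (HasZeta q p ∧ IsQPow q s p)
    by_cases hz : HasZeta q p
    · have hsum : ∑ s ∈ S, ind (HasZeta q p ∧ IsQPow q s p) =
          ((S.filter (fun s => IsQPow q s p)).card : ℝ) := by
        rw [card_filter]
        push_cast
        refine sum_congr rfl fun s _ => ?_
        simp [ind, hz]
      have hind : ind (HasZeta q p) = 1 := by simp [ind, hz]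
      rw [hsum, hind, mul_one]
      by_cases h0 : idealCount F p = 0
      · rw [h0]
        simp only [Nat.cast_zero, mul_zero, add_zero]
        exact_mod_cast hall p p.2 hno2
      · have h1 := (hF p p.2 hno1 h0).2
        rw [filter_true_of_mem h1]
        have h2 : ((S.card : ℝ) - T - 1) / 2 ^ d * (idealCount F p : ℝ) ≤
            ((S.card : ℝ) - T - 1) / 2 ^ d * 2 ^ d :=
          mul_le_mul_of_nonneg_left hid (div_nonneg (by linarith) (by positivity))
        rw [div_mul_cancel₀ _ (by positivity)] at h2
        linarith
    · have h0 : idealCount F p = 0 := by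
        by_contra h0
        exact hz (hF p p.2 hno1 h0).1
      rw [h0]
      simp [ind, hz])
  rw [sum_const, nsmul_eq_mul] at hkey
  have hq2 : (2 : ℝ) ≤ q := by exact_mod_cast hq.two_le
  have hc' : (S.card : ℝ) ≤ q * (T + 1) := by exact_mod_cast hc
  have hq1 : (0 : ℝ) < q - 1 := by linarith
  have e1 : (S.card : ℝ) * (1 / (q * (q - 1))) ≤ (T + 1) * (1 / (q - 1)) := by
    rw [mul_one_div, mul_one_div, div_le_div_iff₀ (by positivity) hq1]
    nlinarith
  have hT : (0 : ℝ) ≤ T := Nat.cast_nonneg T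
  have e2 : ((S.card : ℝ) - T - 1) / 2 ^ d ≤ 0 := by linarith
  have e3 : (S.card : ℝ) = T + 1 := by
    have : (S.card : ℝ) - T - 1 ≤ 0 := by
      by_contra h
      push Not at h
      have : 0 < ((S.card : ℝ) - T - 1) / 2 ^ d := by positivity
      linarith
    linarith
  rw [e3] at hkey
  have e4 : ((T : ℝ) + 1) * (1 / (q * (q - 1))) < (T + 1) * (1 / (q - 1)) := by
    apply mul_lt_mul_of_pos_left _ (by positivity)
    apply one_div_lt_one_div_of_lt hq1
    nlinarith
  have e5 : ((T : ℝ) + 1 - T - 1) / 2 ^ d * 1 = 0 := by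
    have : (T : ℝ) + 1 - T - 1 = 0 := by ring
    rw [this]; simp
  linarith

theorem exists_bad_modulus (q : ℕ) (hq : q.Prime) (Δ : ℕ) (hΔ : 0 < Δ) (k : ℕ) :
    ∀ S : Finset ℤ, (∀ s ∈ S, ¬ ∃ r : ℤ, r ^ q = s) →
      S.card ≤ ∑ i ∈ Finset.Icc 1 k, q ^ i →
      ∃ N : ℕ, 0 < N ∧ N.primeFactorsList.length ≤ k ∧ Nat.Coprime N Δ ∧
        ∀ s ∈ S, ∀ x : ℤ, ¬ (N : ℤ) ∣ x ^ q - s := by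
  induction k with
  | zero =>
    intro S _ hc
    have : S = ∅ := by simpa using hc
    subst this
    exact ⟨1, one_pos, by simp, by simp, by simp⟩
  | succ k ih =>
    intro S hS hc
    have hsum : ∑ i ∈ Finset.Icc 1 (k + 1), q ^ i = q * ((∑ i ∈ Finset.Icc 1 k, q ^ i) + 1) := by
      clear ih hc
      induction k with
      | zero => simp
      | succ k ih =>
        have h1 := Finset.sum_Icc_succ_top (a := 1) (b := k + 1) (by omega) (fun i => q ^ i)
        have h2 := Finset.sum_Icc_succ_top (a := 1) (b := k) (by omega) (fun i => q ^ i)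
        rw [h1, h2]
        rw [h2] at ih
        linear_combination ih
    rw [hsum] at hc
    obtain ⟨p, hp, hpd, S', hS', hc', hbad⟩ := exists_good_prime q hq S hS _ hc Δ hΔ
    obtain ⟨N, hN, hlen, hcop, hNb⟩ := ih S' (fun s hs => hS s (hS' hs)) hc'
    refine ⟨p * N, Nat.mul_pos hp.pos hN, ?_, ?_, ?_⟩
    · rw [(Nat.perm_primeFactorsList_mul hp.ne_zero hN.ne').length_eq, List.length_append,
        Nat.primeFactorsList_prime hp]
      simp only [List.length_singleton]
      omega
    · exact Nat.Coprime.mul_left ((Nat.Prime.coprime_iff_not_dvd hp).2 hpd) hcop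
    · intro s hs x hdvd
      push_cast at hdvd
      by_cases h : s ∈ S'
      · exact hNb s h x ((Dvd.intro_left _ rfl).trans hdvd)
      · apply hbad s hs h
        refine ⟨(x : ZMod p), ?_⟩
        have h1 : (p : ℤ) ∣ x ^ q - s := (Dvd.intro _ rfl).trans hdvd
        have h2 := (ZMod.intCast_zmod_eq_zero_iff_dvd _ p).2 h1
        push_cast at h2
        exact sub_eq_zero.1 h2

/-- **Corollary.** If `|S| ≤ q^k + q^{k-1} + ⋯ + q`, then `S ∈ 𝒯_{k,q}` iff `S` contains a
perfect `q`-th power. -/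
theorem stmt9 (q k : ℕ) (hq : q.Prime) (hodd : Odd q) (hk : 1 ≤ k)
    (S : Finset ℤ) (hcard : S.card ≤ ∑ i ∈ Finset.Icc 1 k, q ^ i) :
    MemT q k ↑S ↔ ∃ s ∈ S, IsPerfectPow q s := by
  constructor
  · rintro ⟨Δ, hΔ, hmem⟩
    by_contra hno
    obtain ⟨N, hN, hlen, hcop, hbad⟩ := exists_bad_modulus q hq Δ hΔ k S
      (fun s hs h => hno ⟨s, hs, h⟩) hcard
    obtain ⟨s, hs, x, hx⟩ := hmem N hN hlen hcop
    exact hbad s (Finset.mem_coe.1 hs) x hx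
  · rintro ⟨s, hs, r, hr⟩
    refine ⟨1, one_pos, fun N _ _ _ => ⟨s, Finset.mem_coe.2 hs, r, ?_⟩⟩
    rw [hr, sub_self]
    exact dvd_zero _
end
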